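/- arXiv:math/0310121 — 4 statements merged into one kernel-verified Lean document; each statement's English description precedes it below -/
import Mathlib

section
/- Let (W,S) be a Coxeter system with Bruhat order, s ∈ S, u ≤ w with u < us, w < ws, and us ≰ w. Then the map ζ : [u,w] → [us,ws] defined by ζ(v) = vs is an order-isomorphism of Bruhat intervals. -/
/-- Bruhat order on a Coxeter group, defined via the subword property:
`u ≤ v` iff some reduced word for `v` contains a reduced word for `u` as a subword. -/
def bruhatLE {B W : Type*} [Group W] {M : CoxeterMatrix B}
    (cs : CoxeterSystem M W) (u v : W) : Prop :=
  ∃ lv lu : List B, cs.IsReduced lv ∧ cs.wordProd lv = v ∧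
    cs.IsReduced lu ∧ cs.wordProd lu = u ∧ lu.Sublist lv

/-- Strict Bruhat order. -/
def bruhatLT {B W : Type*} [Group W] {M : CoxeterMatrix B}
    (cs : CoxeterSystem M W) (u v : W) : Prop :=
  bruhatLE cs u v ∧ u ≠ v

namespace BruhatAux

open Classical in
/-- The generator action on `W × ZMod 2` used for the strong exchange property. -/
noncomputable def gen {B W : Type*} [Group W] {M : CoxeterMatrix B}
    (cs : CoxeterSystem M W) (i : B) : Function.End (W × ZMod 2) :=
  fun p => (cs.simple i * p.1 * cs.simple i, p.2 + if p.1 = cs.simple i then 1 else 0)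

section
variable {B W : Type*} [Group W] {M : CoxeterMatrix B} (cs : CoxeterSystem M W)

open Classical in
theorem gen_pow (i j : B) (n : ℕ) (r : W) (z : ZMod 2) :
    ((gen cs i * gen cs j) ^ n) (r, z) =
      ((cs.simple i * cs.simple j) ^ n * r * ((cs.simple i * cs.simple j) ^ n)⁻¹,
        z + ∑ k ∈ Finset.range (2 * n),
          if r = cs.simple j * (cs.simple i * cs.simple j) ^ k then 1 else 0) := by
  induction n with
  | zero => simp; rfl
  | succ n ih =>
    rw [pow_succ']
    change (gen cs i * gen cs j) (((gen cs i * gen cs j) ^ n) (r, z)) = _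
    rw [ih]
    change gen cs i (gen cs j _) = _
    set c := cs.simple i * cs.simple j with hc
    have hj : cs.simple j * cs.simple j = 1 := cs.simple_mul_simple_self j
    have hi : cs.simple i * cs.simple i = 1 := cs.simple_mul_simple_self i
    have hcj : ∀ k : ℕ, c ^ k * cs.simple j * c ^ k = cs.simple j := by
      intro k
      induction k with
      | zero => simp
      | succ k ihk =>
        rw [pow_succ']
        have : c * c ^ k * cs.simple j * (c * c ^ k) =
            c * (c ^ k * cs.simple j * c ^ k) * c := by
          have hcomm := ((Commute.refl c).pow_right k).eq
          calc _ = c * c ^ k * cs.simple j * (c ^ k * c) := by rw [hcomm]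
            _ = _ := by simp only [mul_assoc]
        rw [this, ihk, hc]
        calc cs.simple i * cs.simple j * cs.simple j * (cs.simple i * cs.simple j)
            = cs.simple i * (cs.simple j * cs.simple j) * cs.simple i * cs.simple j := by group
          _ = cs.simple j := by rw [hj, mul_one, hi, one_mul]
    have hcj' : ∀ k : ℕ, cs.simple j * c ^ k = (c ^ k)⁻¹ * cs.simple j := by
      intro k
      rw [eq_inv_mul_iff_mul_eq, ← mul_assoc, hcj]
    have e1 : (c ^ n * r * (c ^ n)⁻¹ = cs.simple j) ↔ r = cs.simple j * c ^ (2 * n) := by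
      rw [two_mul, pow_add, ← mul_assoc, hcj', mul_inv_eq_iff_eq_mul, mul_assoc,
        eq_inv_mul_iff_mul_eq]
    have e2 : (cs.simple j * (c ^ n * r * (c ^ n)⁻¹) * cs.simple j = cs.simple i) ↔
        r = cs.simple j * c ^ (2 * n + 1) := by
      have : cs.simple j * c ^ (2 * n + 1) =
          (c ^ n)⁻¹ * (cs.simple j * cs.simple i * cs.simple j) * c ^ n := by
        rw [show 2 * n + 1 = n + 1 + n by ring, pow_add, pow_add, pow_one, ← mul_assoc,
          ← mul_assoc, hcj', hc]
        simp only [mul_assoc]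
      rw [this]
      constructor
      · intro h
        rw [← h]
        have : cs.simple j * (cs.simple j * (c ^ n * r * (c ^ n)⁻¹) * cs.simple j) * cs.simple j
          = (cs.simple j * cs.simple j) * (c ^ n * r * (c ^ n)⁻¹) *
            (cs.simple j * cs.simple j) := by simp only [mul_assoc]
        rw [this, hj]; group
      · intro h
        rw [h]
        have : cs.simple j * (c ^ n * ((c ^ n)⁻¹ * (cs.simple j * cs.simple i * cs.simple j) * c ^ n)
            * (c ^ n)⁻¹) * cs.simple j =
            (cs.simple j * cs.simple j) * cs.simple i * (cs.simple j * cs.simple j) := by group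
        rw [this, hj]; group
    rw [show 2 * (n + 1) = 2 * n + 1 + 1 by ring, Finset.sum_range_succ, Finset.sum_range_succ]
    unfold gen
    ext
    · simp only [pow_succ', mul_inv_rev, hc, cs.inv_simple, mul_assoc]
    · simp only [e1, e2, add_assoc]

theorem gen_liftable : M.IsLiftable (gen cs) := by
  classical
  intro i j
  funext p
  obtain ⟨r, z⟩ := p
  rw [gen_pow]
  have h := cs.simple_mul_simple_pow i j
  rw [two_mul, Finset.sum_range_add]
  simp only [pow_add, h, one_mul]
  rw [CharTwo.add_self_eq_zero]
  simp; rfl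

noncomputable def rep : W →* Function.End (W × ZMod 2) := cs.lift ⟨gen cs, gen_liftable cs⟩

open Classical in
theorem rep_word (ω : List B) (r : W) (z : ZMod 2) :
    rep cs (cs.wordProd ω) (r, z) =
      (cs.wordProd ω * r * (cs.wordProd ω)⁻¹, z + ((cs.rightInvSeq ω).count r : ZMod 2)) := by
  induction ω with
  | nil => simp; rfl
  | cons i ω ih =>
    rw [cs.wordProd_cons, map_mul]
    change rep cs (cs.simple i) (rep cs (cs.wordProd ω) (r, z)) = _
    rw [ih, rep, cs.lift_apply_simple]
    have e : (cs.wordProd ω * r * (cs.wordProd ω)⁻¹ = cs.simple i) ↔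
        (cs.wordProd ω)⁻¹ * cs.simple i * cs.wordProd ω = r := by
      constructor
      · intro h; rw [← h]; group
      · intro h; rw [← h]; group
    unfold gen
    ext
    · simp only [mul_inv_rev, cs.inv_simple, mul_assoc]
    · simp only [e, CoxeterSystem.rightInvSeq, List.count_cons, beq_iff_eq]
      push_cast
      simp only [add_assoc]

noncomputable def eta (w r : W) : ZMod 2 := (rep cs w (r, 0)).2

theorem rep_eq (w r : W) (z : ZMod 2) : rep cs w (r, z) = (w * r * w⁻¹, z + eta cs w r) := by
  classical
  obtain ⟨ω, rfl⟩ := cs.wordProd_surjective w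
  rw [eta, rep_word, rep_word]; simp

theorem eta_mul (a b r : W) : eta cs (a * b) r = eta cs b r + eta cs a (b * r * b⁻¹) := by
  rw [eta, map_mul]
  change (rep cs a (rep cs b (r, 0))).2 = _
  rw [rep_eq, rep_eq]; simp

open Classical in
theorem eta_word (ω : List B) (r : W) :
    eta cs (cs.wordProd ω) r = ((cs.rightInvSeq ω).count r : ZMod 2) := by
  rw [eta, rep_word]; simp

theorem eta_one (r : W) : eta cs 1 r = 0 := by
  rw [eta, map_one]; rfl

theorem eta_simple (i : B) : eta cs (cs.simple i) (cs.simple i) = 1 := by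
  classical
  rw [← cs.wordProd_singleton, eta_word]; simp

theorem eta_refl {t : W} (ht : cs.IsReflection t) : eta cs t t = 1 := by
  obtain ⟨x, i, rfl⟩ := ht
  have h1 : eta cs (x * x⁻¹) (x * cs.simple i * x⁻¹) = 0 := by rw [mul_inv_cancel, eta_one]
  rw [eta_mul] at h1
  rw [eta_mul, eta_mul]
  have e : x⁻¹ * (x * cs.simple i * x⁻¹) * x⁻¹⁻¹ = cs.simple i := by group
  rw [e] at h1 ⊢
  have e' : cs.simple i * cs.simple i * (cs.simple i)⁻¹ = cs.simple i := by group
  rw [e', eta_simple, add_comm 1, ← add_assoc, h1, zero_add]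

theorem strong_exchange (ω : List B) {t : W} (ht : cs.IsReflection t)
    (h : cs.length (cs.wordProd ω * t) < cs.length (cs.wordProd ω)) :
    ∃ j < ω.length, cs.wordProd ω * t = cs.wordProd (ω.eraseIdx j) := by
  classical
  have hmem : t ∈ cs.rightInvSeq ω := by
    by_contra hn
    have h0 : eta cs (cs.wordProd ω) t = 0 := by
      rw [eta_word, List.count_eq_zero_of_not_mem hn]; simp
    have h1 : eta cs (cs.wordProd ω * t) t = 1 := by
      rw [eta_mul, eta_refl cs ht, mul_inv_cancel_right, h0, add_zero]
    obtain ⟨ρ, hρ, e⟩ := cs.exists_isReduced (cs.wordProd ω * t)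
    rw [e, eta_word] at h1
    have hm : t ∈ cs.rightInvSeq ρ := by
      by_contra hn'
      rw [List.count_eq_zero_of_not_mem hn'] at h1
      simp at h1
    have := (cs.isRightInversion_of_mem_rightInvSeq hρ hm).2
    rw [← e, mul_assoc, ht.mul_self, mul_one] at this
    omega
  obtain ⟨j, hj, rfl⟩ := List.mem_iff_getElem.mp hmem
  refine ⟨j, by simpa using hj, ?_⟩
  rw [← List.getD_eq_getElem _ 1 hj, cs.wordProd_mul_getD_rightInvSeq]

/-- One step of the Bruhat graph. -/
def Step (u v : W) : Prop :=
  ∃ t, cs.IsReflection t ∧ v = u * t ∧ cs.length u < cs.length v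

/-- The chain version of the Bruhat order. -/
def Chain (u v : W) : Prop := Relation.ReflTransGen (Step cs) u v

variable {cs}

theorem Chain.trans {a b c : W} (h : Chain cs a b) (h' : Chain cs b c) : Chain cs a c :=
  Relation.ReflTransGen.trans h h'

theorem Chain.length {a b : W} (h : Chain cs a b) : a = b ∨ cs.length a < cs.length b := by
  induction h with
  | refl => exact Or.inl rfl
  | tail _ h ih =>
    obtain ⟨t, _, _, hl⟩ := h
    rcases ih with rfl | ih
    · exact Or.inr hl
    · exact Or.inr (ih.trans hl)

theorem chain_up {a : W} {s : B} (h : cs.length a < cs.length (a * cs.simple s)) :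
    Chain cs a (a * cs.simple s) :=
  Relation.ReflTransGen.single ⟨_, cs.isReflection_simple s, rfl, h⟩

theorem chain_down {a : W} {s : B} (h : cs.length (a * cs.simple s) < cs.length a) :
    Chain cs (a * cs.simple s) a :=
  Relation.ReflTransGen.single ⟨_, cs.isReflection_simple s, by simp [mul_assoc], h⟩

theorem step_sub {u w : W} (h : Step cs u w) (ω : List B) (hω : cs.wordProd ω = w) :
    ∃ ρ : List B, ρ.Sublist ω ∧ cs.wordProd ρ = u := by
  obtain ⟨t, ht, rfl, hl⟩ := h
  have e : cs.wordProd ω * t = u := by rw [hω, mul_assoc, ht.mul_self, mul_one]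
  obtain ⟨j, _, hj⟩ := strong_exchange cs ω ht (by rw [e, hω]; exact hl)
  exact ⟨ω.eraseIdx j, List.eraseIdx_sublist .., by rw [← hj, e]⟩

theorem chain_sub {u w : W} (h : Chain cs u w) (ω : List B) (hω : cs.wordProd ω = w) :
    ∃ ρ : List B, ρ.Sublist ω ∧ cs.wordProd ρ = u := by
  induction h using Relation.ReflTransGen.head_induction_on with
  | refl => exact ⟨ω, List.Sublist.refl _, hω⟩
  | head h _ ih =>
    obtain ⟨ρ, h1, h2⟩ := ih
    obtain ⟨σ, h3, h4⟩ := step_sub h ρ h2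
    exact ⟨σ, h3.trans h1, h4⟩

theorem exists_reduced_sub (ω : List B) :
    ∃ ρ : List B, ρ.Sublist ω ∧ cs.IsReduced ρ ∧ cs.wordProd ρ = cs.wordProd ω := by
  induction ω using List.reverseRecOn with
  | nil => exact ⟨[], List.Sublist.refl _, by simp [CoxeterSystem.IsReduced], rfl⟩
  | append_singleton ω s ih =>
    obtain ⟨ρ, h1, h2, h3⟩ := ih
    have h2' : cs.length (cs.wordProd ρ) = ρ.length := h2
    rcases cs.length_mul_simple (cs.wordProd ρ) s with h | h
    · refine ⟨ρ ++ [s], h1.append (List.Sublist.refl _), ?_, ?_⟩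
      · simp only [CoxeterSystem.IsReduced, cs.wordProd_append, cs.wordProd_singleton,
          List.length_append, List.length_singleton]
        omega
      · simp only [cs.wordProd_append, h3]
    · obtain ⟨j, hj, e⟩ := strong_exchange cs ρ (cs.isReflection_simple s) (by omega)
      refine ⟨ρ.eraseIdx j, ((List.eraseIdx_sublist ..).trans h1).trans
        (List.sublist_append_left _ _), ?_, ?_⟩
      · have := List.length_eraseIdx_add_one hj
        simp only [CoxeterSystem.IsReduced]
        rw [← e]; omega
      · rw [← e, cs.wordProd_append, cs.wordProd_singleton, h3]

theorem step_mul {x y : W} (s : B) (h : Step cs x y) :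
    Chain cs (x * cs.simple s) y ∨ Chain cs (x * cs.simple s) (y * cs.simple s) := by
  obtain ⟨t, ht, hy, hl⟩ := h
  have hss := cs.simple_mul_simple_self s
  have hr : cs.IsReflection (cs.simple s * t * cs.simple s) := by
    have := ht.conj (cs.simple s)
    rwa [cs.inv_simple] at this
  have e : x * cs.simple s * (cs.simple s * t * cs.simple s) = y * cs.simple s := by
    rw [hy]
    calc _ = x * (cs.simple s * cs.simple s) * t * cs.simple s := by group
      _ = _ := by rw [hss, mul_one]
  have hne := hr.length_mul_left_ne (x * cs.simple s)
  rw [e] at hne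
  rcases lt_or_gt_of_ne hne with h | h
  · left
    obtain ⟨ω, hω, hx⟩ := cs.exists_isReduced x
    have hωl : cs.length (cs.wordProd ω) = ω.length := hω
    have ew : cs.wordProd (ω ++ [s]) = x * cs.simple s := by
      rw [cs.wordProd_append, cs.wordProd_singleton, hx]
    obtain ⟨j, hj, hje⟩ := strong_exchange cs (ω ++ [s]) hr (by rw [ew, e]; exact h)
    rw [ew, e] at hje
    simp only [List.length_append, List.length_singleton] at hj
    rcases Nat.lt_succ_iff_lt_or_eq.mp hj with hj' | hj'
    · rw [List.eraseIdx_append_of_lt_length hj', cs.wordProd_append, cs.wordProd_singleton] at hje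
      have hy' := mul_right_cancel hje
      have l1 := cs.length_wordProd_le (ω.eraseIdx j)
      have l2 := List.length_eraseIdx_add_one hj'
      rw [← hy'] at l1
      rw [← hx] at hωl
      omega
    · rw [List.eraseIdx_append_of_length_le (by omega), hj'] at hje
      simp only [Nat.sub_self, List.eraseIdx_cons_zero, List.append_nil] at hje
      rw [← hx] at hje
      rw [← hje, mul_assoc, hss, mul_one]
      exact Relation.ReflTransGen.refl
  · right
    exact Relation.ReflTransGen.single ⟨_, hr, e.symm, h⟩

theorem chain_mul {x y : W} (s : B) (h : Chain cs x y) :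
    Chain cs (x * cs.simple s) y ∨ Chain cs (x * cs.simple s) (y * cs.simple s) := by
  induction h using Relation.ReflTransGen.head_induction_on with
  | refl => exact Or.inr Relation.ReflTransGen.refl
  | head h h' ih =>
    rcases step_mul s h with h1 | h1
    · exact Or.inl (h1.trans h')
    · exact ih.imp h1.trans h1.trans

theorem chain_mul_up {x y : W} {s : B} (h : Chain cs x y)
    (hy : cs.length y < cs.length (y * cs.simple s)) :
    Chain cs (x * cs.simple s) (y * cs.simple s) := by
  rcases chain_mul s h with h | h
  · exact h.trans (chain_up hy)
  · exact h

theorem sub_chain (ω : List B) : cs.IsReduced ω → ∀ ρ : List B, ρ.Sublist ω →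
    Chain cs (cs.wordProd ρ) (cs.wordProd ω) := by
  induction ω using List.reverseRecOn with
  | nil => intro _ ρ h; rw [List.sublist_nil.mp h]; exact Relation.ReflTransGen.refl
  | append_singleton ω s ih =>
    intro hω ρ h
    have hω' : cs.IsReduced ω := by
      have := hω.take ω.length
      simpa using this
    have hl : cs.length (cs.wordProd ω) < cs.length (cs.wordProd ω * cs.simple s) := by
      have h1 : cs.length (cs.wordProd (ω ++ [s])) = (ω ++ [s]).length := hω
      have h2 : cs.length (cs.wordProd ω) = ω.length := hω'
      rw [cs.wordProd_append, cs.wordProd_singleton] at h1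
      simp at h1; omega
    rw [cs.wordProd_append ω, cs.wordProd_singleton]
    obtain ⟨ρ1, ρ2, rfl, h1, h2⟩ := List.sublist_append_iff.mp h
    rcases List.sublist_singleton.mp h2 with rfl | rfl
    · rw [List.append_nil]
      exact (ih hω' _ h1).trans (chain_up hl)
    · rw [cs.wordProd_append, cs.wordProd_singleton]
      exact chain_mul_up (ih hω' _ h1) hl

theorem le_iff {u w : W} : bruhatLE cs u w ↔ Chain cs u w := by
  constructor
  · rintro ⟨lv, lu, h1, rfl, _, rfl, h⟩
    exact sub_chain lv h1 lu h
  · intro h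
    obtain ⟨ω, hω, rfl⟩ := cs.exists_isReduced w
    obtain ⟨ρ, h1, h2⟩ := chain_sub h ω rfl
    obtain ⟨σ, h3, h4, h5⟩ := exists_reduced_sub (cs := cs) ρ
    exact ⟨ω, σ, hω, rfl, h4, h5.trans h2, h3.trans h1⟩

/-- Lifting: if `x ≤ ys` and `y < ys` then `x ≤ y` or `xs ≤ y`. -/
theorem lift_chain {x y : W} {s : B} (h : Chain cs x (y * cs.simple s))
    (hy : cs.length y < cs.length (y * cs.simple s)) :
    Chain cs x y ∨ Chain cs (x * cs.simple s) y := by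
  obtain ⟨ω, hω, rfl⟩ := cs.exists_isReduced y
  obtain ⟨ρ, h0, rfl⟩ := chain_sub h (ω ++ [s]) (by rw [cs.wordProd_append, cs.wordProd_singleton])
  obtain ⟨ρ1, ρ2, rfl, h1, h2⟩ := List.sublist_append_iff.mp h0
  rcases List.sublist_singleton.mp h2 with rfl | rfl
  · left
    rw [List.append_nil]
    exact sub_chain ω hω _ h1
  · right
    rw [cs.wordProd_append, cs.wordProd_singleton, mul_assoc, cs.simple_mul_simple_self, mul_one]
    exact sub_chain ω hω _ h1

/-- Lifting, for `x < xs`. -/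
theorem lift_up {x y : W} {s : B} (h : Chain cs x (y * cs.simple s))
    (hy : cs.length y < cs.length (y * cs.simple s))
    (hx : cs.length x < cs.length (x * cs.simple s)) : Chain cs x y := by
  rcases lift_chain h hy with h | h
  · exact h
  · exact (chain_up hx).trans h

/-- Lifting, for `x < xs`, applied to `xs`. -/
theorem lift_down {x y : W} {s : B} (h : Chain cs (x * cs.simple s) (y * cs.simple s))
    (hy : cs.length y < cs.length (y * cs.simple s))
    (hx : cs.length x < cs.length (x * cs.simple s)) : Chain cs x y := by
  rcases lift_chain h hy with h | h
  · exact (chain_up hx).trans h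
  · rwa [mul_assoc, cs.simple_mul_simple_self, mul_one] at h

end

end BruhatAux

/-- if `u < us`, `w < ws`, `u ≤ w` and `us ≰ w`, then
`ζ : [u,w] → [us,ws]`, `ζ(v) = vs`, is an order-isomorphism of Bruhat intervals. -/
theorem bruhat_interval_iso_shift {B W : Type*} [Group W] {M : CoxeterMatrix B}
    (cs : CoxeterSystem M W) (u w : W) (s : B)
    (huw : bruhatLE cs u w)
    (hu : bruhatLT cs u (u * cs.simple s))
    (hw : bruhatLT cs w (w * cs.simple s))
    (hus : ¬ bruhatLE cs (u * cs.simple s) w) :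
    ∃ f : {v : W // bruhatLE cs u v ∧ bruhatLE cs v w} ≃
          {v : W // bruhatLE cs (u * cs.simple s) v ∧ bruhatLE cs v (w * cs.simple s)},
      (∀ v, (f v).val = v.val * cs.simple s) ∧
      (∀ a b, bruhatLE cs a.val b.val ↔ bruhatLE cs (f a).val (f b).val) := by
  have hu' : cs.length u < cs.length (u * cs.simple s) :=
    (BruhatAux.le_iff.mp hu.1).length.resolve_left hu.2
  have hw' : cs.length w < cs.length (w * cs.simple s) :=
    (BruhatAux.le_iff.mp hw.1).length.resolve_left hw.2
  rw [BruhatAux.le_iff] at hus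
  have hss : ∀ v : W, v * cs.simple s * cs.simple s = v := fun v => by
    rw [mul_assoc, cs.simple_mul_simple_self, mul_one]
  have up : ∀ v : W, BruhatAux.Chain cs u v → BruhatAux.Chain cs v w →
      cs.length v < cs.length (v * cs.simple s) := by
    intro v h1 h2
    by_contra hn
    have hd : cs.length (v * cs.simple s) < cs.length (v * cs.simple s * cs.simple s) := by
      rw [hss]
      have := cs.length_mul_simple_ne v s
      omega
    have h3 : BruhatAux.Chain cs u (v * cs.simple s) :=
      BruhatAux.lift_up (by rwa [hss]) hd hu'
    have h4 := BruhatAux.chain_mul_up h3 hd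
    rw [hss] at h4
    exact hus (h4.trans h2)
  have down : ∀ v : W, BruhatAux.Chain cs (u * cs.simple s) v →
      BruhatAux.Chain cs v (w * cs.simple s) →
      cs.length (v * cs.simple s) < cs.length (v * cs.simple s * cs.simple s) := by
    intro v h1 h2
    rw [hss]
    by_contra hn
    have hd : cs.length v < cs.length (v * cs.simple s) := by
      have := cs.length_mul_simple_ne v s
      omega
    exact hus (h1.trans (BruhatAux.lift_up h2 hw' hd))
  refine ⟨⟨fun v => ⟨v.1 * cs.simple s, ?_, ?_⟩, fun v => ⟨v.1 * cs.simple s, ?_, ?_⟩,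
    fun v => Subtype.ext (hss _), fun v => Subtype.ext (hss _)⟩, fun v => rfl, fun a b => ?_⟩
  · rw [BruhatAux.le_iff]
    exact BruhatAux.chain_mul_up (BruhatAux.le_iff.mp v.2.1) (up v.1 (BruhatAux.le_iff.mp v.2.1) (BruhatAux.le_iff.mp v.2.2))
  · rw [BruhatAux.le_iff]
    exact BruhatAux.chain_mul_up (BruhatAux.le_iff.mp v.2.2) hw'
  · rw [BruhatAux.le_iff]
    have hd := down v.1 (BruhatAux.le_iff.mp v.2.1) (BruhatAux.le_iff.mp v.2.2)
    exact BruhatAux.lift_down (by rw [hss]; exact (BruhatAux.le_iff.mp v.2.1)) hd hu'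
  · rw [BruhatAux.le_iff]
    have hd := down v.1 (BruhatAux.le_iff.mp v.2.1) (BruhatAux.le_iff.mp v.2.2)
    exact BruhatAux.lift_down (by rw [hss]; exact (BruhatAux.le_iff.mp v.2.2)) hw' hd
  · rw [BruhatAux.le_iff, BruhatAux.le_iff]
    have ha := up a.1 (BruhatAux.le_iff.mp a.2.1) (BruhatAux.le_iff.mp a.2.2)
    have hb := up b.1 (BruhatAux.le_iff.mp b.2.1) (BruhatAux.le_iff.mp b.2.2)
    exact ⟨fun h => BruhatAux.chain_mul_up h hb, fun h => BruhatAux.lift_down h hb ha⟩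
end

section
/- Let (W,S) be a Coxeter system with Bruhat order. Every Bruhat interval [u,v] with l(v) − l(u) = 2 contains exactly two elements of intermediate length; that is, Bruhat order is thin. -/
namespace Thin

open CoxeterSystem

variable {B W : Type*} [Group W] {M : CoxeterMatrix B} (cs : CoxeterSystem M W)

open Classical in
/-- The basic signed-reflection map. -/
noncomputable def g (i : B) (p : W × ZMod 2) : W × ZMod 2 :=
  (cs.simple i * p.1 * cs.simple i, p.2 + if p.1 = cs.simple i then 1 else 0)

theorem g_g (i : B) (p : W × ZMod 2) : g cs i (g cs i p) = p := by
  have h : (cs.simple i * p.1 * cs.simple i = cs.simple i) ↔ p.1 = cs.simple i := by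
    constructor
    · intro h
      have := congrArg (fun x => cs.simple i * x * cs.simple i) h
      simpa [mul_assoc] using this
    · intro h; simp [h]
  ext
  · simp [g, mul_assoc]
  · unfold g
    by_cases hp : p.1 = cs.simple i
    · rw [if_pos (h.2 hp), if_pos hp, add_assoc, CharTwo.add_self_eq_zero, add_zero]
    · rw [if_neg (fun h' => hp (h.1 h')), if_neg hp, add_zero, add_zero]

/-- The basic signed-reflection permutation. -/
noncomputable def f (i : B) : Equiv.Perm (W × ZMod 2) :=
  ⟨g cs i, g cs i, g_g cs i, g_g cs i⟩

open Classical in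
theorem f_apply (i : B) (p : W × ZMod 2) :
    f cs i p = (cs.simple i * p.1 * cs.simple i,
      p.2 + if p.1 = cs.simple i then 1 else 0) := rfl

open Classical in
theorem ff_pow (i j : B) (n : ℕ) (p : W × ZMod 2) :
    ((f cs i * f cs j) ^ n) p =
      ((cs.simple i * cs.simple j) ^ n * p.1 * ((cs.simple i * cs.simple j) ^ n)⁻¹,
        p.2 + ∑ k ∈ Finset.range (2 * n),
          if p.1 = ((cs.simple i * cs.simple j) ^ k)⁻¹ * cs.simple j then 1 else 0) := by
  have hinv : (cs.simple i * cs.simple j)⁻¹ = cs.simple j * cs.simple i := by simp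
  have hcomm : ∀ k : ℕ, cs.simple j * (cs.simple i * cs.simple j) ^ k
      = ((cs.simple i * cs.simple j) ^ k)⁻¹ * cs.simple j := by
    intro k
    induction k with
    | zero => simp
    | succ k ih =>
      rw [pow_succ, ← mul_assoc, ih, mul_inv_rev]
      rw [hinv]
      have := pow_succ (cs.simple i * cs.simple j)⁻¹ k
      have h2 := pow_succ' (cs.simple i * cs.simple j)⁻¹ k
      rw [h2] at this
      rw [hinv] at this
      rw [← inv_pow, hinv, this]
      simp [mul_assoc]
  induction n with
  | zero => simp
  | succ n ih =>
    rw [pow_succ', Equiv.Perm.mul_apply, ih, Equiv.Perm.mul_apply, f_apply, f_apply]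
    set q := cs.simple i * cs.simple j with hq
    have h1 : (q ^ n * p.1 * (q ^ n)⁻¹ = cs.simple j) ↔
        p.1 = (q ^ (2 * n))⁻¹ * cs.simple j := by
      rw [mul_inv_eq_iff_eq_mul, hcomm, ← eq_inv_mul_iff_mul_eq, ← mul_assoc, two_mul, pow_add,
        mul_inv_rev]
    have h2 : (cs.simple j * (q ^ n * p.1 * (q ^ n)⁻¹) * cs.simple j = cs.simple i) ↔
        p.1 = (q ^ (2 * n + 1))⁻¹ * cs.simple j := by
      have e : (q ^ (2 * n + 1))⁻¹ = (q ^ n)⁻¹ * q⁻¹ * (q ^ n)⁻¹ := by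
        rw [← mul_inv_rev, ← mul_inv_rev, ← pow_succ', ← pow_add]
        congr 2; ring
      rw [e, mul_assoc _ (q ^ n)⁻¹ (cs.simple j), ← hcomm, hinv]
      have s1 : ∀ x, cs.simple j * x * cs.simple j = cs.simple i ↔
          x = cs.simple j * cs.simple i * cs.simple j := by
        intro x
        constructor
        · intro h; rw [← h]; simp [mul_assoc]
        · intro h; rw [h]; simp [mul_assoc]
      rw [s1, mul_inv_eq_iff_eq_mul, ← eq_inv_mul_iff_mul_eq]
      simp only [mul_assoc]
    rw [show 2 * (n + 1) = 2 * n + 1 + 1 by ring, Finset.sum_range_succ, Finset.sum_range_succ]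
    simp only [h1, h2]
    ext
    · rw [pow_succ' q n, mul_inv_rev, hinv]
      simp only [hq, mul_assoc]
    · simp only [add_assoc]

theorem f_liftable : M.IsLiftable (f cs) := by
  classical
  intro i j
  ext p : 1
  rw [ff_pow, cs.simple_mul_simple_pow, two_mul, Finset.sum_range_add]
  simp only [pow_add, cs.simple_mul_simple_pow, one_mul]
  rw [CharTwo.add_self_eq_zero]
  simp

/-- The signed-reflection representation. -/
noncomputable def phi : W →* Equiv.Perm (W × ZMod 2) := cs.lift ⟨f cs, f_liftable cs⟩

theorem phi_simple (i : B) : phi cs (cs.simple i) = f cs i := cs.lift_apply_simple _ i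

open Classical in
theorem phi_word (ω : List B) (p : W × ZMod 2) :
    phi cs (cs.wordProd ω) p = (cs.wordProd ω * p.1 * (cs.wordProd ω)⁻¹,
      p.2 + ((cs.rightInvSeq ω).count p.1 : ZMod 2)) := by
  induction ω with
  | nil => simp
  | cons i ω ih =>
    rw [cs.wordProd_cons, map_mul, Equiv.Perm.mul_apply, ih, phi_simple, f_apply]
    have h : (cs.wordProd ω * p.1 * (cs.wordProd ω)⁻¹ = cs.simple i) ↔
        ((cs.wordProd ω)⁻¹ * cs.simple i * cs.wordProd ω = p.1) := by
      rw [mul_inv_eq_iff_eq_mul, mul_assoc, inv_mul_eq_iff_eq_mul]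
      exact eq_comm
    simp only [h, rightInvSeq, List.count_cons]
    ext
    · simp [mul_assoc]
    · simp [add_assoc]

/-- Reflection cocycle. -/
noncomputable def eta (w t : W) : ZMod 2 := (phi cs w (t, 0)).2

theorem phi_eq (w t : W) (e : ZMod 2) : phi cs w (t, e) = (w * t * w⁻¹, e + eta cs w t) := by
  obtain ⟨ω, -, rfl⟩ := cs.exists_isReduced w
  simp [eta, phi_word]

theorem eta_mul (w v t : W) : eta cs (w * v) t = eta cs v t + eta cs w (v * t * v⁻¹) := by
  rw [eta, map_mul, Equiv.Perm.mul_apply, phi_eq, phi_eq]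
  simp

theorem eta_self {t : W} (ht : cs.IsReflection t) : eta cs t t = 1 := by
  obtain ⟨a, i, rfl⟩ := ht
  have h0 : eta cs (a * a⁻¹) (a * cs.simple i * a⁻¹) = 0 := by simp [eta]
  have hs : eta cs (cs.simple i) (cs.simple i) = 1 := by simp [eta, phi_simple, f_apply]
  rw [eta_mul] at h0
  rw [mul_assoc a, eta_mul, ← mul_assoc a, eta_mul]
  have e1 : a⁻¹ * (a * cs.simple i * a⁻¹) * a⁻¹⁻¹ = cs.simple i := by group
  have e2 : cs.simple i * a⁻¹ * (a * cs.simple i * a⁻¹) * (cs.simple i * a⁻¹)⁻¹ = cs.simple i := by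
    simp [mul_assoc]
  rw [e1] at h0 ⊢
  rw [e2, hs, add_right_comm, h0, zero_add]

theorem mem_of_eta {ω : List B} {t : W} (h : eta cs (cs.wordProd ω) t ≠ 0) :
    t ∈ cs.rightInvSeq ω := by
  classical
  by_contra hn
  apply h
  simp [eta, phi_word, List.count_eq_zero_of_not_mem hn]

/-- Strong exchange. -/
theorem strong_exchange {ω : List B} {t : W} (ht : cs.IsReflection t)
    (hl : cs.length (cs.wordProd ω * t) < cs.length (cs.wordProd ω)) :
    t ∈ cs.rightInvSeq ω := by
  by_contra hn
  have h0 : eta cs (cs.wordProd ω) t = 0 := by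
    by_contra h; exact hn (mem_of_eta cs h)
  have h1 : eta cs (cs.wordProd ω * t) t = 1 := by
    rw [eta_mul, eta_self cs ht]
    simp [h0]
  obtain ⟨ω', hr, he⟩ := cs.exists_isReduced (cs.wordProd ω * t)
  rw [he] at h1
  have hm := mem_of_eta cs (ω := ω') (t := t) (by rw [h1]; exact one_ne_zero)
  have := (cs.isRightInversion_of_mem_rightInvSeq hr hm).2
  rw [← he, mul_assoc, ht.mul_self, mul_one] at this
  omega

theorem exchange_erase {ω : List B} {t : W} (ht : cs.IsReflection t)
    (hl : cs.length (cs.wordProd ω * t) < cs.length (cs.wordProd ω)) :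
    ∃ j < ω.length, cs.wordProd ω * t = cs.wordProd (ω.eraseIdx j) := by
  obtain ⟨j, hj, e⟩ := List.getElem_of_mem (strong_exchange cs ht hl)
  refine ⟨j, by simpa using hj, ?_⟩
  rw [← cs.wordProd_mul_getD_rightInvSeq, List.getD_eq_getElem _ _ hj, e]

/-- Covering relation. -/
def Cov (u x : W) : Prop := cs.IsReflection (u⁻¹ * x) ∧ cs.length x = cs.length u + 1

theorem isReflection_symm {u x : W} (h : cs.IsReflection (u⁻¹ * x)) :
    cs.IsReflection (x⁻¹ * u) := by
  have := h.isReflection_inv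
  simpa using this

theorem cov_erase {u x : W} (h : Cov cs u x) {ω : List B} (hx : x = cs.wordProd ω) :
    ∃ j < ω.length, u = cs.wordProd (ω.eraseIdx j) := by
  have hr := isReflection_symm cs h.1
  subst hx
  have e : cs.wordProd ω * ((cs.wordProd ω)⁻¹ * u) = u := by group
  have := exchange_erase cs (ω := ω) hr (by rw [e, h.2]; omega)
  rwa [e] at this

theorem lifting {x v : W} (i : B) (h : Cov cs x v)
    (hv : cs.length (cs.simple i * v) + 1 = cs.length v)
    (hx : cs.length (cs.simple i * x) = cs.length x + 1) : x = cs.simple i * v := by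
  obtain ⟨ω, hr, he⟩ := cs.exists_isReduced (cs.simple i * v)
  have hv' : v = cs.wordProd (i :: ω) := by rw [cs.wordProd_cons, ← he]; simp
  obtain ⟨j, hj, e⟩ := cov_erase cs h hv'
  rcases j with _ | j
  · simpa [he] using e
  · exfalso
    have e2 : cs.simple i * x = cs.wordProd (ω.eraseIdx j) := by
      rw [e]; simp [cs.wordProd_cons]
    have h1 := cs.length_wordProd_le (ω.eraseIdx j)
    have h2 : (ω.eraseIdx j).length + 1 = ω.length :=
      List.length_eraseIdx_add_one (by simpa using hj)
    have h3 := hr.eq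
    have h4 := h.2
    rw [← e2] at h1
    rw [← he] at h3
    omega

theorem cov_mul {u x : W} (i : B) (h : Cov cs u x)
    (hl : cs.length (cs.simple i * x) = cs.length (cs.simple i * u) + 1) :
    Cov cs (cs.simple i * u) (cs.simple i * x) := by
  refine ⟨?_, hl⟩
  have : (cs.simple i * u)⁻¹ * (cs.simple i * x) = u⁻¹ * x := by simp [mul_assoc]
  rw [this]; exact h.1

theorem cov_simple {v : W} (i : B) (hv : cs.length (cs.simple i * v) + 1 = cs.length v) :
    Cov cs (cs.simple i * v) v := by
  refine ⟨?_, hv.symm⟩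
  have := (cs.isReflection_simple i).conj v⁻¹
  simpa [mul_assoc] using this

/-- The open interval. -/
def X (u v : W) : Set W := {x | Cov cs u x ∧ Cov cs x v}

open Classical in
theorem maps {u v : W} (i : B) (hv : cs.length (cs.simple i * v) + 1 = cs.length v)
    (hu : cs.length (cs.simple i * u) + 1 = cs.length u) {x : W} (hx : x ∈ X cs u v) :
    (if x = cs.simple i * v then u else cs.simple i * x)
      ∈ X cs (cs.simple i * u) (cs.simple i * v) := by
  obtain ⟨h1, h2⟩ := hx
  split_ifs with h
  · subst h
    exact ⟨cov_simple cs i hu, h1⟩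
  · have hx : cs.length (cs.simple i * x) + 1 = cs.length x := by
      rcases cs.length_simple_mul x i with h' | h'
      · exact absurd (lifting cs i h2 hv h') h
      · exact h'
    have := h1.2
    have := h2.2
    exact ⟨cov_mul cs i h1 (by omega), cov_mul cs i h2 (by omega)⟩

open Classical in
theorem maps_inv {u v : W} (i : B) (hv : cs.length (cs.simple i * v) + 1 = cs.length v)
    (hu : cs.length (cs.simple i * u) + 1 = cs.length u) {y : W}
    (hy : y ∈ X cs (cs.simple i * u) (cs.simple i * v)) :
    (if y = u then cs.simple i * v else cs.simple i * y) ∈ X cs u v := by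
  obtain ⟨h1, h2⟩ := hy
  split_ifs with h
  · subst h
    exact ⟨h2, cov_simple cs i hv⟩
  · have hx : cs.length (cs.simple i * y) = cs.length y + 1 := by
      rcases cs.length_simple_mul y i with h' | h'
      · exact h'
      · have := lifting cs i h1 h' (by simp; omega)
        exact absurd (mul_left_cancel this).symm h
    have := h1.2
    have := h2.2
    have a := cov_mul cs i h1 (by simp; omega)
    have b := cov_mul cs i h2 (by simp; omega)
    simp only [cs.simple_mul_simple_cancel_left] at a b
    exact ⟨a, b⟩

theorem ncard_eq {u v : W} (i : B) (hv : cs.length (cs.simple i * v) + 1 = cs.length v)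
    (hu : cs.length (cs.simple i * u) + 1 = cs.length u) :
    (X cs u v).ncard = (X cs (cs.simple i * u) (cs.simple i * v)).ncard := by
  classical
  refine Set.ncard_congr (fun x _ => if x = cs.simple i * v then u else cs.simple i * x)
    (fun x hx => maps cs i hv hu hx) ?_ ?_
  · intro a b ha hb hab
    have key : ∀ c ∈ X cs u v, cs.simple i * c ≠ u := by
      intro c hc h
      have h1 := hc.1.2
      have h2 := hc.2.2
      have : c = cs.simple i * u := by rw [← h]; simp
      rw [this] at h1; omega
    split_ifs at hab with h1 h2 h2
    · rw [h1, h2]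
    · exact absurd hab.symm (key b hb)
    · exact absurd hab (key a ha)
    · exact mul_left_cancel hab
  · intro y hy
    refine ⟨_, maps_inv cs i hv hu hy, ?_⟩
    by_cases h : y = u
    · simp [h]
    · have : cs.simple i * y ≠ cs.simple i * v := by
        intro h'
        have h1 := hy.2.2
        rw [mul_left_cancel h'] at h1
        omega
      simp [h, this]

theorem reduced_tail {a : B} {l : List B} (h : cs.IsReduced (a :: l)) : cs.IsReduced l := by
  simpa using h.drop 1

theorem length_cons {a : B} {l : List B} (h : cs.IsReduced (a :: l)) :
    cs.length (cs.simple a * cs.wordProd (a :: l)) + 1 = cs.length (cs.wordProd (a :: l)) := by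
  have h1 := h.eq
  have h2 := (reduced_tail cs h).eq
  rw [h1, cs.wordProd_cons, cs.simple_mul_simple_cancel_left, h2, List.length_cons]

theorem cov_of_sublist {lu lv : List B} (h : lu.Sublist lv) (hv : cs.IsReduced lv)
    (hu : cs.IsReduced lu) (hl : lv.length = lu.length + 1) :
    Cov cs (cs.wordProd lu) (cs.wordProd lv) := by
  induction h with
  | slnil => simp at hl
  | @cons l₁ l₂ a h ih =>
    have : l₁ = l₂ := h.eq_of_length (by simpa using hl.symm)
    subst this
    have := cov_simple cs a (length_cons cs hv)
    simpa [cs.wordProd_cons] using this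
  | @cons_cons l₁ l₂ a h ih =>
    have h1 := ih (reduced_tail cs hv) (reduced_tail cs hu) (by simpa using hl)
    have h2 := hu.eq
    have h3 := hv.eq
    rw [cs.wordProd_cons] at h2 h3 ⊢
    rw [cs.wordProd_cons]
    exact cov_mul cs a h1 (by omega)

theorem nonempty_X {lu lv : List B} (h : lu.Sublist lv) (hv : cs.IsReduced lv)
    (hu : cs.IsReduced lu) (hl : lv.length = lu.length + 2) :
    (X cs (cs.wordProd lu) (cs.wordProd lv)).Nonempty := by
  classical
  induction h with
  | slnil => simp at hl
  | @cons l₁ l₂ a h ih =>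
    refine ⟨cs.wordProd l₂, cov_of_sublist cs h (reduced_tail cs hv) hu (by simpa using hl), ?_⟩
    exact cov_of_sublist cs (List.sublist_cons_self a l₂) hv (reduced_tail cs hv) (by simp)
  | @cons_cons l₁ l₂ a h ih =>
    obtain ⟨y, hy⟩ := ih (reduced_tail cs hv) (reduced_tail cs hu) (by simpa using hl)
    refine ⟨_, maps_inv cs a (length_cons cs hv) (length_cons cs hu) (y := y) ?_⟩
    simpa [cs.wordProd_cons] using hy

theorem ncard_X (n : ℕ) : ∀ u v : W, cs.length v = n → (X cs u v).Nonempty →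
    (X cs u v).ncard = 2 := by
  classical
  induction n with
  | zero =>
    rintro u v hv ⟨x, h1, h2⟩
    have := h2.2
    omega
  | succ n ih =>
    rintro u v hv ⟨x, hx⟩
    have l1 := hx.1.2
    have l2 := hx.2.2
    have hne : v ≠ 1 := by
      rintro rfl
      simp at hv
    obtain ⟨i, hi⟩ := cs.exists_leftDescent_of_ne_one hne
    rw [cs.isLeftDescent_iff] at hi
    rcases cs.length_simple_mul u i with hu | hu
    · have hsub : ∀ y ∈ X cs u v, y = cs.simple i * u ∨ y = cs.simple i * v := by
        intro y hy
        rcases cs.length_simple_mul y i with h | h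
        · exact Or.inr (lifting cs i hy.2 hi h)
        · left
          have := lifting cs i hy.1 h hu
          rw [this]; simp
      have hcu : Cov cs u (cs.simple i * u) := by
        have := cov_simple cs (v := cs.simple i * u) i (by simp; omega)
        simpa using this
      have hcv := cov_simple cs i hi
      have hboth : Cov cs u (cs.simple i * v) ∧ Cov cs (cs.simple i * u) v := by
        rcases hsub x hx with h | h
        · have h2 := hx.2
          rw [h] at h2
          have := cov_mul cs i h2 (by simp; omega)
          exact ⟨by simpa using this, h2⟩
        · have h1 := hx.1
          rw [h] at h1
          have := cov_mul cs i h1 (by simp; omega)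
          exact ⟨h1, by simpa using this⟩
      have hX : X cs u v = {cs.simple i * u, cs.simple i * v} := by
        ext y
        constructor
        · intro hy; exact hsub y hy
        · rintro (rfl | rfl)
          · exact ⟨hcu, hboth.2⟩
          · exact ⟨hboth.1, hcv⟩
      rw [hX]
      apply Set.ncard_pair
      intro h
      have := mul_left_cancel h
      rw [this] at l1
      omega
    · rw [ncard_eq cs i hi hu]
      exact ih _ _ (by omega) ⟨_, maps cs i hi hu hx⟩

theorem le_length {u v : W} (h : bruhatLT cs u v) : cs.length u < cs.length v := by
  obtain ⟨⟨lv, lu, hv, rfl, hu, rfl, hs⟩, hne⟩ := h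
  rw [hv.eq, hu.eq]
  refine lt_of_le_of_ne hs.length_le fun h => hne ?_
  rw [hs.eq_of_length h]

theorem cov_of_lt {u v : W} (h : bruhatLT cs u v) (hl : cs.length v = cs.length u + 1) :
    Cov cs u v := by
  obtain ⟨⟨lv, lu, hv, rfl, hu, rfl, hs⟩, -⟩ := h
  rw [hv.eq, hu.eq] at hl
  exact cov_of_sublist cs hs hv hu hl

theorem lt_of_cov {u v : W} (h : Cov cs u v) : bruhatLT cs u v := by
  have hl := h.2
  refine ⟨?_, by rintro rfl; omega⟩
  obtain ⟨ω, hr, he⟩ := cs.exists_isReduced v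
  obtain ⟨j, hj, hu⟩ := cov_erase cs h he
  refine ⟨ω, ω.eraseIdx j, hr, he.symm, ?_, hu.symm, List.eraseIdx_sublist _ _⟩
  have h1 := List.length_eraseIdx_add_one hj
  have h2 := hr.eq
  rw [← he] at h2
  unfold CoxeterSystem.IsReduced
  rw [← hu]
  omega

end Thin

/-- Bruhat order is thin: every Bruhat interval `[u,v]` with
`l(v) = l(u) + 2` contains exactly two elements of intermediate length. -/
theorem bruhat_order_thin {B W : Type*} [Group W] {M : CoxeterMatrix B}
    (cs : CoxeterSystem M W) (u v : W)
    (huv : bruhatLE cs u v)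
    (hl : cs.length v = cs.length u + 2) :
    {x : W | bruhatLT cs u x ∧ bruhatLT cs x v}.ncard = 2 := by
  have hX : {x : W | bruhatLT cs u x ∧ bruhatLT cs x v} = Thin.X cs u v := by
    ext x
    constructor
    · rintro ⟨h1, h2⟩
      have l1 := Thin.le_length cs h1
      have l2 := Thin.le_length cs h2
      exact ⟨Thin.cov_of_lt cs h1 (by omega), Thin.cov_of_lt cs h2 (by omega)⟩
    · rintro ⟨h1, h2⟩
      exact ⟨Thin.lt_of_cov cs h1, Thin.lt_of_cov cs h2⟩
  rw [hX]
  apply Thin.ncard_X cs _ u v rfl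
  obtain ⟨lv, lu, hv, rfl, hu, rfl, hs⟩ := huv
  rw [hv.eq, hu.eq] at hl
  exact Thin.nonempty_X cs hs hv hu hl
end

section
/- For every graded poset P with 0̂ and 1̂, the flag h-vector of any lower Bruhat interval [1,w] in a Coxeter group is coefficientwise bounded above by the flag h-vector of the Boolean algebra of rank l(w): β_{[1,w]}(S) ≤ β_{B_{l(w)}}(S) for all S ⊆ [l(w)−1]. -/
/-- The flag f-vector of a (bounded) poset-like structure given by a relation `r`,
a rank function `rk`, and bottom/top elements: `flagAlpha r rk bot top T` is the
number of chains in the open interval `(bot, top)` whose set of ranks is exactly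
`T`. -/
noncomputable def flagAlpha {α : Type*} (r : α → α → Prop) (rk : α → ℕ)
    (bot top : α) (T : Finset ℕ) : ℕ :=
  Set.ncard {C : Finset α |
    (∀ a ∈ C, ∀ b ∈ C, r a b ∨ r b a) ∧
    (∀ a ∈ C, r bot a ∧ r a top ∧ a ≠ bot ∧ a ≠ top) ∧
    C.image rk = T}

/-- The flag h-vector: `β(T) = ∑_{T' ⊆ T} (−1)^{|T−T'|} α(T')`. -/
noncomputable def flagBeta {α : Type*} (r : α → α → Prop) (rk : α → ℕ)
    (bot top : α) (T : Finset ℕ) : ℤ :=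
  ∑ T' ∈ T.powerset, (-1 : ℤ) ^ ((T \ T').card) * (flagAlpha r rk bot top T' : ℤ)

namespace BFH

section Cox

variable {B W : Type*} [Group W] {M : CoxeterMatrix B} (cs : CoxeterSystem M W)

open Classical in
/-- The generator action on `W × ZMod 2`. -/
noncomputable def gen (i : B) : Function.End (W × ZMod 2) := fun p =>
  (cs.simple i * p.1 * cs.simple i, p.2 + if p.1 = cs.simple i then 1 else 0)

open Classical in
theorem gen_pow (i j : B) (k : ℕ) (t : W) (e : ZMod 2) :
    ((gen cs i * gen cs j) ^ k) (t, e) =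
      ((cs.simple i * cs.simple j) ^ k * t * ((cs.simple i * cs.simple j) ^ k)⁻¹,
        e + ∑ r ∈ Finset.range (2 * k),
          if t = cs.simple j * (cs.simple i * cs.simple j) ^ r then 1 else 0) := by
  set a := cs.simple i with ha
  set b := cs.simple j with hb
  have haa : a * a = 1 := cs.simple_mul_simple_self i
  have hbb : b * b = 1 := cs.simple_mul_simple_self j
  have hai : a⁻¹ = a := cs.inv_simple i
  have hbi : b⁻¹ = b := cs.inv_simple j
  have hpb : ∀ q : ℕ, ((a * b) ^ q)⁻¹ * b = b * (a * b) ^ q := by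
    intro q
    have h1 : b * (a * b) * b⁻¹ = (a * b)⁻¹ := by
      rw [mul_inv_rev, hai, hbi]; simp [mul_assoc, hbb]
    have h2 : b * (a * b) ^ q * b⁻¹ = ((a * b) ^ q)⁻¹ := by
      rw [← conj_pow, h1, inv_pow]
    rw [← h2]; simp
  induction k with
  | zero => simp; rfl
  | succ k ih =>
    rw [pow_succ']
    change (gen cs i) ((gen cs j) (((gen cs i * gen cs j) ^ k) (t, e))) = _
    rw [ih]
    simp only [gen, ← ha, ← hb]
    have e1 : ((a * b) ^ k * t * ((a * b) ^ k)⁻¹ = b) ↔ t = b * (a * b) ^ (2 * k) := by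
      rw [mul_inv_eq_iff_eq_mul, ← eq_inv_mul_iff_mul_eq, ← mul_assoc, hpb, mul_assoc, ← pow_add,
        two_mul]
    have e2 : (b * ((a * b) ^ k * t * ((a * b) ^ k)⁻¹) * b = a) ↔
        t = b * (a * b) ^ (2 * k + 1) := by
      rw [show b * ((a * b) ^ k * t * ((a * b) ^ k)⁻¹) * b = b * ((a * b) ^ k * t * ((a * b) ^ k)⁻¹) * b⁻¹ by rw [hbi]]
      rw [mul_inv_eq_iff_eq_mul, ← eq_inv_mul_iff_mul_eq, mul_inv_eq_iff_eq_mul, 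
        ← eq_inv_mul_iff_mul_eq, hbi, ← mul_assoc, ← mul_assoc, hpb]
      rw [show b * (a * b) ^ k * (a * b) * (a * b) ^ k = b * (a * b) ^ (2 * k + 1) by
        rw [mul_assoc, mul_assoc, ← pow_succ', ← pow_add]; congr 2; omega]
    refine Prod.ext ?_ ?_
    · simp only [pow_succ', mul_inv_rev, hai, hbi, mul_assoc]
    · simp only [e1, e2]
      rw [show 2 * (k + 1) = 2 * k + 1 + 1 by ring, Finset.sum_range_succ, Finset.sum_range_succ]
      ring

theorem gen_liftable : M.IsLiftable (gen cs) := by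
  classical
  intro i j
  funext ⟨t, e⟩
  rw [gen_pow, cs.simple_mul_simple_pow, two_mul, Finset.sum_range_add]
  simp only [pow_add, cs.simple_mul_simple_pow, one_mul, CharTwo.add_self_eq_zero]
  simp
  rfl

/-- The action of `W` on `W × ZMod 2`. -/
noncomputable def act : W →* Function.End (W × ZMod 2) := cs.lift ⟨gen cs, gen_liftable cs⟩

open Classical in
theorem act_word (l : List B) (t : W) (e : ZMod 2) :
    act cs (cs.wordProd l) (t, e) = (cs.wordProd l * t * (cs.wordProd l)⁻¹,
      e + ((cs.rightInvSeq l).count t : ℕ)) := by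
  induction l with
  | nil => simp; rfl
  | cons i l ih =>
    rw [cs.wordProd_cons, map_mul]
    change act cs (cs.simple i) (act cs (cs.wordProd l) (t, e)) = _
    rw [ih, act, cs.lift_apply_simple]
    simp only [gen, CoxeterSystem.rightInvSeq, List.count_cons, mul_inv_rev, cs.inv_simple]
    refine Prod.ext (by simp only [mul_assoc]) ?_
    have : (cs.wordProd l * t * (cs.wordProd l)⁻¹ = cs.simple i) ↔
      ((cs.wordProd l)⁻¹ * cs.simple i * cs.wordProd l == t) = true := by
      rw [beq_iff_eq, mul_inv_eq_iff_eq_mul, ← eq_inv_mul_iff_mul_eq, mul_assoc, eq_comm]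
    simp only [this]
    push_cast
    ring

theorem act_add (w t : W) (e : ZMod 2) :
    act cs w (t, e) = (w * t * w⁻¹, e + (act cs w (t, 0)).2) := by
  obtain ⟨l, rfl⟩ := cs.wordProd_surjective w
  simp [act_word]

theorem act_refl {t : W} (ht : cs.IsReflection t) : (act cs t (t, 0)).2 = 1 := by
  obtain ⟨u, i, rfl⟩ := ht
  set t := u * cs.simple i * u⁻¹ with ht
  have h0 : act cs u (act cs u⁻¹ (t, 0)) = (t, 0) := by
    change (act cs u * act cs u⁻¹) (t, 0) = _
    rw [← map_mul]; simp; rfl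
  have hc : u⁻¹ * t * u⁻¹⁻¹ = cs.simple i := by simp [ht, mul_assoc]
  rw [act_add cs u⁻¹, hc, act_add] at h0
  have h1 : act cs t (t, 0) = act cs u (act cs (cs.simple i) (act cs u⁻¹ (t, 0))) := by
    change _ = (act cs u * act cs (cs.simple i) * act cs u⁻¹) (t, 0)
    rw [← map_mul, ← map_mul]
  have h2 : (act cs (cs.simple i) (cs.simple i, 0)).2 = 1 := by
    rw [act, cs.lift_apply_simple]; simp [gen]
  rw [h1, act_add cs u⁻¹, hc, act_add cs (cs.simple i), h2]
  simp only [cs.inv_simple, cs.simple_mul_simple_self, one_mul]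
  rw [act_add]
  have h3 := congrArg Prod.snd h0
  simp only at h3 ⊢
  linear_combination h3

theorem strong_exchange (l : List B) {t : W} (ht : cs.IsReflection t)
    (h : cs.length (cs.wordProd l * t) < cs.length (cs.wordProd l)) :
    ∃ j, j < l.length ∧ cs.wordProd l * t = cs.wordProd (l.eraseIdx j) := by
  classical
  by_cases hm : t ∈ cs.rightInvSeq l
  · obtain ⟨j, hj, rfl⟩ := List.mem_iff_getElem.mp hm
    refine ⟨j, by simpa using hj, ?_⟩
    rw [← cs.wordProd_mul_getD_rightInvSeq, List.getD_eq_getElem]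
  · exfalso
    have h0 : (act cs (cs.wordProd l) (t, 0)).2 = 0 := by
      rw [act_word, List.count_eq_zero_of_not_mem hm]; simp
    obtain ⟨l', hl', he⟩ := cs.exists_isReduced (cs.wordProd l * t)
    have h1 : (act cs (cs.wordProd l * t) (t, 0)).2 = 1 := by
      rw [map_mul]
      change (act cs (cs.wordProd l) (act cs t (t, 0))).2 = 1
      rw [act_add cs t, act_refl cs ht]
      simp only [mul_inv_cancel_right]
      rw [act_add, h0]; simp
    rw [he, act_word] at h1
    have hm' : t ∈ cs.rightInvSeq l' := by
      by_contra hn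
      rw [List.count_eq_zero_of_not_mem hn] at h1
      simp at h1
    have := (cs.isRightInversion_of_mem_rightInvSeq hl' hm').2
    rw [← he, mul_assoc, ht.mul_self, mul_one] at this
    omega

theorem exchange_mul (x y : W) {t : W} (ht : cs.IsReflection t)
    (h : cs.length (x * y * t) < cs.length (x * y)) :
    (∃ x', cs.length x' < cs.length x ∧ x * y * t = x' * y) ∨
    (∃ y', cs.length y' < cs.length y ∧ x * y * t = x * y') := by
  obtain ⟨lx, hx, rfl⟩ := cs.exists_isReduced x
  obtain ⟨ly, hy, rfl⟩ := cs.exists_isReduced y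
  rw [← cs.wordProd_append] at h ⊢
  obtain ⟨j, hj, he⟩ := strong_exchange cs _ ht h
  rw [he]
  by_cases hlt : j < lx.length
  · left
    refine ⟨cs.wordProd (lx.eraseIdx j), ?_, ?_⟩
    · rw [hx.eq]
      have := cs.length_wordProd_le (lx.eraseIdx j)
      have := List.length_eraseIdx_add_one hlt
      omega
    · rw [List.eraseIdx_append_of_lt_length hlt, cs.wordProd_append]
  · right
    push Not at hlt
    refine ⟨cs.wordProd (ly.eraseIdx (j - lx.length)), ?_, ?_⟩
    · rw [hy.eq]
      have := cs.length_wordProd_le (ly.eraseIdx (j - lx.length))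
      simp at hj
      have := List.length_eraseIdx_add_one (l := ly) (i := j - lx.length) (by omega)
      omega
    · rw [List.eraseIdx_append_of_length_le hlt, cs.wordProd_append]

theorem length_insert (x y : W) (i : B) (hxy : cs.length (x * y) = cs.length x + cs.length y)
    (hx : cs.length x < cs.length (x * cs.simple i))
    (hy : cs.length y < cs.length (cs.simple i * y)) :
    cs.length (x * (cs.simple i * y)) = cs.length x + cs.length (cs.simple i * y) := by
  have hr : cs.IsReflection (y⁻¹ * cs.simple i * y) := ⟨y⁻¹, i, by simp⟩
  have he : x * y * (y⁻¹ * cs.simple i * y) = x * (cs.simple i * y) := by group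
  have hne := hr.length_mul_left_ne (x * y)
  have hsy := cs.length_simple_mul y i
  have hle := cs.length_mul_le x (cs.simple i * y)
  rcases lt_or_gt_of_ne hne with h | h
  · exfalso
    rcases exchange_mul cs x y hr h with ⟨x', h1, h2⟩ | ⟨y', h1, h2⟩
    · rw [he, ← mul_assoc] at h2
      have := mul_right_cancel h2
      rw [this] at hx; omega
    · rw [he] at h2
      have := mul_left_cancel h2
      rw [this] at hy; omega
  · rw [he] at h; omega

theorem step_lemma (x q : W) (i : B) (hq : cs.IsReflection q) (hne : q ≠ cs.simple i)
    (h : cs.length x < cs.length (x * q)) :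
    cs.length (x * cs.simple i) < cs.length (x * q * cs.simple i) := by
  have h1 := cs.length_mul_simple x i
  have h2 := cs.length_mul_simple (x * q) i
  rcases h1 with h1 | h1
  · by_contra hcon
    have hr : cs.IsReflection (cs.simple i * q * cs.simple i) := by
      have := hq.conj (cs.simple i)
      rwa [cs.inv_simple] at this
    have he : x * cs.simple i * (cs.simple i * q * cs.simple i) = x * q * cs.simple i := by
      simp [mul_assoc]
    have hlt : cs.length (x * cs.simple i * (cs.simple i * q * cs.simple i)) <
        cs.length (x * cs.simple i) := by
      have := hr.length_mul_left_ne (x * cs.simple i)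
      rw [he] at this ⊢
      omega
    rcases exchange_mul cs _ _ hr hlt with ⟨x', h3, h4⟩ | ⟨y', h3, h4⟩
    · rw [he] at h4
      have := mul_right_cancel h4
      rw [this] at h; omega
    · rw [he, mul_assoc] at h4
      have h5 := mul_left_cancel h4
      rw [cs.length_simple] at h3
      have h6 : y' = 1 := cs.length_eq_zero_iff.mp (by omega)
      rw [h6] at h5
      apply hne
      rw [← cs.inv_simple]
      exact eq_inv_of_mul_eq_one_left h5
  · omega

/-- One upward reflection step. -/
def bstep (x y : W) : Prop := ∃ q, cs.IsReflection q ∧ y = x * q ∧ cs.length x < cs.length y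

/-- Bruhat order by reflection steps. -/
def ble (x y : W) : Prop := Relation.ReflTransGen (bstep cs) x y

theorem ble_length {x y : W} (h : ble cs x y) : cs.length x ≤ cs.length y := by
  induction h with
  | refl => exact le_rfl
  | tail _ h ih => obtain ⟨q, _, _, h⟩ := h; omega

theorem bstep_simple {x : W} {i : B} (h : cs.length x < cs.length (x * cs.simple i)) :
    bstep cs x (x * cs.simple i) := ⟨_, cs.isReflection_simple i, rfl, h⟩

theorem bstep_simple' {x : W} {i : B} (h : cs.length (x * cs.simple i) < cs.length x) :
    bstep cs (x * cs.simple i) x := ⟨_, cs.isReflection_simple i, by simp, h⟩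

theorem bstep_mul {x y : W} (i : B) (h : bstep cs x y) :
    bstep cs (x * cs.simple i) (y * cs.simple i) ∨ y = x * cs.simple i := by
  obtain ⟨q, hq, rfl, h⟩ := h
  by_cases hne : q = cs.simple i
  · right; rw [hne]
  · left
    refine ⟨cs.simple i * q * cs.simple i, ?_, by simp [mul_assoc], step_lemma cs x q i hq hne h⟩
    have := hq.conj (cs.simple i)
    rwa [cs.inv_simple] at this

theorem ble_mul {x y : W} (i : B) (h : ble cs x y) :
    ble cs (x * cs.simple i) (y * cs.simple i) ∨ ble cs x (y * cs.simple i) := by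
  induction h with
  | refl => exact Or.inl .refl
  | tail hxy hs ih =>
    rcases bstep_mul cs i hs with h | h
    · rcases ih with ih | ih
      · exact Or.inl (ih.tail h)
      · exact Or.inr (ih.tail h)
    · right; rw [h, cs.simple_mul_simple_cancel_right]; exact hxy

theorem ble_mul' {x y : W} (i : B) (h : ble cs x y) :
    ble cs (x * cs.simple i) (y * cs.simple i) ∨ ble cs (x * cs.simple i) y := by
  induction h using Relation.ReflTransGen.head_induction_on with
  | refl => exact Or.inl .refl
  | head hs hxy ih =>
    rcases bstep_mul cs i hs with h | h
    · rcases ih with ih | ih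
      · exact Or.inl (ih.head h)
      · exact Or.inr (ih.head h)
    · right; rw [← h]; exact hxy

theorem reduced_concat {l : List B} {i : B} (h : cs.IsReduced (l ++ [i])) :
    cs.IsReduced l ∧ cs.length (cs.wordProd l) < cs.length (cs.wordProd l * cs.simple i) := by
  have h1 := h.eq
  have h2 := cs.length_wordProd_le l
  have h3 := cs.length_mul_simple (cs.wordProd l) i
  rw [cs.wordProd_append] at h1
  simp at h1
  unfold CoxeterSystem.IsReduced
  omega

theorem ble_of_sublist (l : List B) : cs.IsReduced l → ∀ l' : List B, l'.Sublist l →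
    ble cs (cs.wordProd l') (cs.wordProd l) := by
  induction l using List.reverseRecOn with
  | nil => 
    intro _ l' h
    rw [List.sublist_nil.mp h]; exact .refl
  | append_singleton l i ih =>
    intro hl l' h
    obtain ⟨hl0, hlt⟩ := reduced_concat cs hl
    have hup : bstep cs (cs.wordProd l) (cs.wordProd (l ++ [i])) := by
      rw [cs.wordProd_append]; simpa using bstep_simple cs hlt
    obtain ⟨l1, l2, rfl, h1, h2⟩ := List.sublist_append_iff.mp h
    have := ih hl0 l1 h1
    rcases List.sublist_singleton.mp h2 with rfl | rfl
    · rw [List.append_nil]; exact this.tail hup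
    · rw [cs.wordProd_append l1]
      simp only [cs.wordProd_singleton]
      rcases ble_mul' cs i this with h | h
      · rw [cs.wordProd_append l]; simpa using h
      · exact h.tail hup

theorem ble_of_bruhatLE {u v : W} (h : bruhatLE cs u v) : ble cs u v := by
  obtain ⟨lv, lu, h1, rfl, _, rfl, h⟩ := h
  exact ble_of_sublist cs lv h1 lu h

end Cox

end BFH
namespace BFH

section Cox2

variable {B W : Type*} [Group W] {M : CoxeterMatrix B} (cs : CoxeterSystem M W)
variable {n : ℕ} (f : Fin n → B)

/-- The subword of `f` at the positions in `A`. -/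
def subw (A : Finset (Fin n)) : List B := (A.sort (· ≤ ·)).map f

/-- Its product. -/
def P (A : Finset (Fin n)) : W := cs.wordProd (subw f A)

/-- The subword is reduced. -/
def Gd (A : Finset (Fin n)) : Prop := cs.length (P cs f A) = A.card

theorem length_subw (A : Finset (Fin n)) : (subw f A).length = A.card := by simp [subw]

theorem Gd_iff (A : Finset (Fin n)) : Gd cs f A ↔ cs.IsReduced (subw f A) := by
  simp [Gd, CoxeterSystem.IsReduced, P, length_subw]

theorem P_empty : P cs f ∅ = 1 := by simp [P, subw]

theorem sort_insert_max {A : Finset (Fin n)} {x : Fin n} (hx : ∀ a ∈ A, a < x) :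
    (insert x A).sort (· ≤ ·) = A.sort (· ≤ ·) ++ [x] := by
  have hxA : x ∉ A := fun h => lt_irrefl _ (hx x h)
  apply List.Perm.eq_of_pairwise' (r := (· ≤ ·))
  · exact Finset.pairwise_sort _ _
  · rw [List.pairwise_append]
    refine ⟨Finset.pairwise_sort _ _, by simp, ?_⟩
    intro a ha b hb
    simp at ha hb
    subst hb
    exact (hx a ha).le
  · rw [List.perm_ext_iff_of_nodup (Finset.sort_nodup _ _)]
    · intro a; simp [or_comm]
    · rw [List.nodup_append]
      refine ⟨Finset.sort_nodup _ _, by simp, ?_⟩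
      intro a ha b hb
      simp at ha hb
      subst hb
      exact (hx a ha).ne

theorem P_insert {A : Finset (Fin n)} {x : Fin n} (hx : ∀ a ∈ A, a < x) :
    P cs f (insert x A) = P cs f A * cs.simple (f x) := by
  rw [P, subw, sort_insert_max hx, List.map_append, cs.wordProd_append]
  simp [P, subw]

theorem P_le (A : Finset (Fin n)) : cs.length (P cs f A) ≤ A.card := by
  have := cs.length_wordProd_le (subw f A)
  rwa [length_subw] at this

theorem Gd_insert {A : Finset (Fin n)} {x : Fin n} (hx : ∀ a ∈ A, a < x) :
    Gd cs f (insert x A) ↔ Gd cs f A ∧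
      cs.length (P cs f A * cs.simple (f x)) = cs.length (P cs f A) + 1 := by
  have hxA : x ∉ A := fun h => lt_irrefl _ (hx x h)
  rw [Gd, P_insert cs f hx, Finset.card_insert_of_notMem hxA, Gd]
  have h1 := P_le cs f A
  have h2 := cs.length_mul_simple (P cs f A) (f x)
  omega

/-- Threshold set: deletions at positions `< c` performed. -/
def thr (A A' : Finset (Fin n)) (c : ℕ) : Finset (Fin n) := A' ∪ A.filter (fun x => c ≤ (x : ℕ))

theorem thr_sub {A A' : Finset (Fin n)} (h : A' ⊆ A) (c : ℕ) : thr A A' c ⊆ A :=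
  Finset.union_subset h (Finset.filter_subset _ _)

theorem thr_insert_insert (A A' : Finset (Fin n)) (x : Fin n) (c : ℕ) :
    thr (insert x A) (insert x A') c = insert x (thr A A' c) := by
  ext a; simp [thr]; tauto

theorem thr_insert_le (A A' : Finset (Fin n)) (x : Fin n) (c : ℕ) (h : c ≤ (x : ℕ)) :
    thr (insert x A) A' c = insert x (thr A A' c) := by
  ext a; simp only [thr, Finset.mem_union, Finset.mem_filter, Finset.mem_insert]
  constructor
  · tauto
  · rintro (rfl | h | h) <;> tauto

theorem thr_insert_gt {A A' : Finset (Fin n)} {x : Fin n} (hx : ∀ a ∈ A, a < x) (c : ℕ)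
    (h : ¬ c ≤ (x : ℕ)) :
    thr (insert x A) A' c = A' ∧ thr A A' c = A' := by
  constructor <;> ext a <;> simp only [thr, Finset.mem_union, Finset.mem_filter, Finset.mem_insert]
  · constructor
    · rintro (h1 | ⟨rfl | h1, h2⟩)
      · exact h1
      · exact absurd h2 h
      · have := hx a h1; omega
    · tauto
  · constructor
    · rintro (h1 | ⟨h1, h2⟩)
      · exact h1
      · have := hx a h1; omega
    · tauto

theorem exists_inc (A : Finset (Fin n)) : Gd cs f A → ∀ u, ble cs u (P cs f A) →
    ∃ A' ⊆ A, P cs f A' = u ∧ (∀ c, Gd cs f (thr A A' c)) ∧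
      ∀ y, cs.length (P cs f A * y) = cs.length (P cs f A) + cs.length y →
        cs.length (u * y) = cs.length u + cs.length y →
        ∀ c, cs.length (P cs f (thr A A' c) * y) = cs.length (P cs f (thr A A' c)) + cs.length y := by
  induction A using Finset.induction_on_max with
  | empty =>
    intro hA u hu
    have h1 := ble_length cs hu
    rw [P_empty, cs.length_one] at h1
    have h2 : u = 1 := cs.length_eq_zero_iff.mp (by omega)
    subst h2
    refine ⟨∅, Finset.Subset.refl _, P_empty cs f, ?_, ?_⟩
    · intro c; simpa [thr] using hA
    · intro y _ _ c; simp [thr, P_empty]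
  | insert x A hx ih =>
    intro hA u hu
    obtain ⟨hA0, hup⟩ := (Gd_insert cs f hx).mp hA
    rw [P_insert cs f hx] at hu
    set s := cs.simple (f x) with hs
    have hss : s * s = 1 := cs.simple_mul_simple_self _
    have hsub : ∀ {A'}, A' ⊆ A → ∀ a ∈ A', a < x := fun h a ha => hx a (h ha)
    have hL := ble_mul cs (f x) hu
    rw [cs.simple_mul_simple_cancel_right, ← hs] at hL
    have hdd := cs.length_mul_simple u (f x)
    rw [← hs] at hdd
    rcases hdd with hd | hd
    · have hu' : ble cs u (P cs f A) := by
        rcases hL with h | h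
        · exact h.head (bstep_simple cs (by rw [← hs]; omega))
        · exact h
      obtain ⟨A', hA', hP, hG, hQ⟩ := ih hA0 u hu'
      have hQ1 := hQ s (by rw [hs, cs.length_simple]; exact hup) (by rw [hs, cs.length_simple]; exact hd)
      refine ⟨A', hA'.trans (Finset.subset_insert _ _), hP, ?_, ?_⟩
      · intro c
        by_cases hc : c ≤ (x : ℕ)
        · rw [thr_insert_le _ _ _ _ hc, Gd_insert cs f (hsub (thr_sub hA' c))]
          refine ⟨hG c, ?_⟩
          have := hQ1 c
          rwa [hs, cs.length_simple] at this
        · obtain ⟨e1, e2⟩ := thr_insert_gt (A' := A') hx c hc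
          rw [e1, ← e2]; exact hG c
      · intro y hy1 hy2 c
        rw [P_insert cs f hx, ← hs, mul_assoc] at hy1
        have a1 := cs.length_mul_le (P cs f A) (s * y)
        have a2 := cs.length_mul_le s y
        rw [cs.length_simple] at a2
        have a3 : cs.length (P cs f A * (s * y)) = cs.length (P cs f A) + cs.length (s * y) := by
          omega
        have a4 : cs.length (s * y) = cs.length y + 1 := by omega
        by_cases hc : c ≤ (x : ℕ)
        · rw [thr_insert_le _ _ _ _ hc, P_insert cs f (hsub (thr_sub hA' c)), mul_assoc,
            ← hs]
          have := hQ (s * y) a3 (length_insert cs u y (f x) hy2 (by rw [← hs]; omega) (by rw [← hs]; omega)) c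
          have h3 := hQ1 c
          rw [cs.length_simple] at h3
          omega
        · obtain ⟨e1, e2⟩ := thr_insert_gt (A' := A') hx c hc
          rw [e1, hP]; exact hy2
    · have hu' : ble cs (u * s) (P cs f A) := by
        rcases hL with h | h
        · exact h
        · exact Relation.ReflTransGen.head (bstep_simple' cs (by rw [← hs]; omega)) h
      obtain ⟨A', hA', hP, hG, hQ⟩ := ih hA0 _ hu'
      have hQ1 := hQ s (by rw [hs, cs.length_simple]; exact hup)
        (by rw [mul_assoc, hss, mul_one, cs.length_simple]; omega)
      refine ⟨insert x A', Finset.insert_subset_insert _ hA', ?_, ?_, ?_⟩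
      · rw [P_insert cs f (hsub hA'), hP, ← hs, mul_assoc, hss, mul_one]
      · intro c
        rw [thr_insert_insert, Gd_insert cs f (hsub (thr_sub hA' c))]
        refine ⟨hG c, ?_⟩
        have := hQ1 c
        rwa [hs, cs.length_simple] at this
      · intro y hy1 hy2 c
        rw [P_insert cs f hx, ← hs, mul_assoc] at hy1
        have a1 := cs.length_mul_le (P cs f A) (s * y)
        have a2 := cs.length_mul_le s y
        rw [cs.length_simple] at a2
        have a3 : cs.length (P cs f A * (s * y)) = cs.length (P cs f A) + cs.length (s * y) := by
          omega
        have a4 : cs.length (s * y) = cs.length y + 1 := by omega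
        rw [thr_insert_insert, P_insert cs f (hsub (thr_sub hA' c)), mul_assoc, ← hs]
        have := hQ (s * y) a3 (by
          rw [← mul_assoc, mul_assoc u, hss, mul_one]; omega) c
        have h3 := hQ1 c
        rw [cs.length_simple] at h3
        omega

theorem unique_inc (A : Finset (Fin n)) : ∀ A' A'', A' ⊆ A → A'' ⊆ A →
    (∀ c, Gd cs f (thr A A' c)) → (∀ c, Gd cs f (thr A A'' c)) →
    P cs f A' = P cs f A'' → A' = A'' := by
  induction A using Finset.induction_on_max with
  | empty =>
    intro A' A'' h1 h2 _ _ _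
    rw [Finset.subset_empty.mp h1, Finset.subset_empty.mp h2]
  | insert x A hx ih =>
    have hsub : ∀ {A'}, A' ⊆ A → ∀ a ∈ A', a < x := fun h a ha => hx a (h ha)
    have key : ∀ A' ⊆ insert x A, (∀ c, Gd cs f (thr (insert x A) A' c)) →
        ∃ A0 ⊆ A, (∀ c, Gd cs f (thr A A0 c)) ∧
          ((A' = insert x A0 ∧ P cs f A' = P cs f A0 * cs.simple (f x) ∧
              cs.length (P cs f A' * cs.simple (f x)) < cs.length (P cs f A')) ∨
           (A' = A0 ∧ cs.length (P cs f A') < cs.length (P cs f A' * cs.simple (f x)))) := by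
      intro A' hA' hG
      have hxA : x ∉ A := fun h => lt_irrefl _ (hx x h)
      have hz : ∀ A0 ⊆ A, thr A A0 (x : ℕ) = A0 := by
        intro A0 h0
        ext a; simp only [thr, Finset.mem_union, Finset.mem_filter]
        constructor
        · rintro (h1 | ⟨h1, h2⟩)
          · exact h1
          · have := hx a h1; omega
        · tauto
      by_cases hxm : x ∈ A'
      · have h0 : A'.erase x ⊆ A := by
          intro a ha
          rw [Finset.mem_erase] at ha
          have := hA' ha.2
          rw [Finset.mem_insert] at this
          tauto
        have he : A' = insert x (A'.erase x) := (Finset.insert_erase hxm).symm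
        have hG' : ∀ c, Gd cs f (insert x (thr A (A'.erase x) c)) := by
          intro c
          rw [← thr_insert_insert, ← he]; exact hG c
        refine ⟨A'.erase x, h0, ?_, Or.inl ⟨he, ?_, ?_⟩⟩
        · intro c
          exact ((Gd_insert cs f (hsub (thr_sub h0 c))).mp (hG' c)).1
        · conv_lhs => rw [he]
          exact P_insert cs f (hsub h0)
        · have h2 := ((Gd_insert cs f (hsub (thr_sub h0 x))).mp (hG' x)).2
          rw [hz _ h0] at h2
          rw [he, P_insert cs f (hsub h0), cs.simple_mul_simple_cancel_right]
          omega
      · have h0 : A' ⊆ A := by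
          intro a ha
          have := hA' ha
          rw [Finset.mem_insert] at this
          rcases this with rfl | h
          · exact absurd ha hxm
          · exact h
        refine ⟨A', h0, ?_, Or.inr ⟨rfl, ?_⟩⟩
        · intro c
          by_cases hc : c ≤ (x : ℕ)
          · have := hG c
            rw [thr_insert_le _ _ _ _ hc] at this
            exact ((Gd_insert cs f (hsub (thr_sub h0 c))).mp this).1
          · obtain ⟨e1, e2⟩ := thr_insert_gt (A' := A') hx c hc
            rw [e2, ← e1]; exact hG c
        · have := hG x
          rw [thr_insert_le _ _ _ _ le_rfl, Gd_insert cs f (hsub (thr_sub h0 x)), hz _ h0] at this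
          omega
    intro A' A'' h1 h2 g1 g2 he
    obtain ⟨A1, s1, q1, c1⟩ := key A' h1 g1
    obtain ⟨A2, s2, q2, c2⟩ := key A'' h2 g2
    rcases c1 with ⟨e1, p1, l1⟩ | ⟨e1, l1⟩ <;> rcases c2 with ⟨e2, p2, l2⟩ | ⟨e2, l2⟩
    · rw [e1, e2, ih A1 A2 s1 s2 q1 q2 (by
        rw [p1, p2] at he; exact mul_right_cancel he)]
    · rw [he] at l1; omega
    · rw [he] at l1; omega
    · rw [e1, e2]; exact ih A1 A2 s1 s2 q1 q2 (by rw [← e1, ← e2, he])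

theorem subw_sublist {A A' : Finset (Fin n)} (h : A' ⊆ A) : (subw f A').Sublist (subw f A) := by
  apply List.Sublist.map
  apply List.sublist_of_subperm_of_pairwise (r := (· ≤ ·))
  · apply List.subperm_of_subset (Finset.sort_nodup _ _)
    intro a ha
    simp at ha ⊢
    exact h ha
  · exact Finset.pairwise_sort _ _
  · exact Finset.pairwise_sort _ _

theorem bruhatLE_of_subset {A A' : Finset (Fin n)} (hA : Gd cs f A) (hA' : Gd cs f A')
    (h : A' ⊆ A) : bruhatLE cs (P cs f A') (P cs f A) :=
  ⟨subw f A, subw f A', (Gd_iff cs f A).mp hA, rfl, (Gd_iff cs f A').mp hA', rfl, subw_sublist f h⟩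

theorem bruhatLE_length {u v : W} (h : bruhatLE cs u v) :
    cs.length u ≤ cs.length v ∧ (cs.length u = cs.length v → u = v) := by
  obtain ⟨lv, lu, h1, rfl, h2, rfl, h⟩ := h
  rw [h1.eq, h2.eq]
  exact ⟨h.length_le, fun he => by rw [h.eq_of_length he]⟩

end Cox2

end BFH
namespace BFH

section Count

variable {n : ℕ}

/-- Descent ranks of a list. -/
def desc : List (Fin n) → Finset ℕ
  | [] => ∅
  | [_] => ∅
  | a :: b :: l => if b < a then insert (l.length + 1) (desc (b :: l)) else desc (b :: l)

theorem desc_lt (L : List (Fin n)) : ∀ i ∈ desc L, i < L.length := by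
  induction L with
  | nil => simp [desc]
  | cons a L ih =>
    cases L with
    | nil => simp [desc]
    | cons b L =>
      intro i hi
      simp only [desc] at hi
      have : i = L.length + 1 ∨ i ∈ desc (b :: L) := by
        split_ifs at hi
        · simpa using hi
        · exact Or.inr hi
      rcases this with rfl | h
      · simp
      · have := ih i h
        simp at this ⊢; omega

theorem desc_cons_sub (a : Fin n) (L : List (Fin n)) : desc L ⊆ desc (a :: L) := by
  cases L with
  | nil => simp [desc]
  | cons b L =>
    simp only [desc]
    split_ifs
    · exact Finset.subset_insert _ _
    · exact Finset.Subset.refl _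

theorem desc_cons_sub' (a : Fin n) (L : List (Fin n)) : desc (a :: L) ⊆ insert L.length (desc L) := by
  cases L with
  | nil => simp [desc]
  | cons b L =>
    simp only [desc]
    split_ifs
    · exact Finset.Subset.refl _
    · exact Finset.subset_insert _ _

theorem desc_append_sub (L1 L2 : List (Fin n)) : desc L2 ⊆ desc (L1 ++ L2) := by
  induction L1 with
  | nil => exact Finset.Subset.refl _
  | cons a L ih => exact ih.trans (desc_cons_sub _ _)

theorem desc_append_sorted (L1 L2 : List (Fin n)) (h : L1.Pairwise (· < ·)) :
    desc (L1 ++ L2) ⊆ insert L2.length (desc L2) := by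
  induction L1 with
  | nil => exact Finset.subset_insert _ _
  | cons a L ih =>
    rw [List.pairwise_cons] at h
    cases L with
    | nil => exact desc_cons_sub' _ _
    | cons b L =>
      have hab := h.1 b (by simp)
      have := ih h.2
      simp only [List.cons_append, desc] at this ⊢
      rw [if_neg (not_lt.mpr hab.le)]
      exact this

theorem sorted_of_desc (L1 L2 : List (Fin n)) (hn : L1.Nodup)
    (h : ∀ i ∈ desc (L1 ++ L2), i ≤ L2.length) : L1.Pairwise (· < ·) := by
  rw [← List.isChain_iff_pairwise]
  induction L1 with
  | nil => exact List.isChain_nil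
  | cons a L ih =>
    cases L with
    | nil => exact List.isChain_singleton _
    | cons b L =>
      rw [List.isChain_cons_cons]
      refine ⟨?_, ih (List.nodup_cons.mp hn).2 fun i hi => h i (desc_cons_sub _ _ hi)⟩
      have hne : a ≠ b := by
        intro he; subst he; simp at hn
      by_contra hlt
      have hlt' : b < a := lt_of_le_of_ne (not_lt.mp hlt) hne.symm
      have := h ((L ++ L2).length + 1) (by
        simp only [List.cons_append, desc, if_pos hlt']
        exact Finset.mem_insert_self _ _)
      simp at this

theorem exists_suffix (L : List (Fin n)) (h : L.Pairwise (· < ·)) (c : ℕ) :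
    ∃ L', L' <:+ L ∧ L'.toFinset = L.toFinset.filter (fun x : Fin n => c ≤ (x : ℕ)) := by
  induction L with
  | nil => exact ⟨[], List.suffix_refl _, by simp⟩
  | cons a L ih =>
    rw [List.pairwise_cons] at h
    by_cases hc : c ≤ (a : ℕ)
    · refine ⟨a :: L, List.suffix_refl _, ?_⟩
      symm
      apply Finset.filter_true_of_mem
      intro x hx
      simp at hx
      rcases hx with rfl | hx
      · exact hc
      · have := h.1 x hx; omega
    · obtain ⟨L', h1, h2⟩ := ih h.2
      refine ⟨L', h1.trans (List.suffix_cons _ _), ?_⟩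
      rw [h2, List.toFinset_cons, Finset.filter_insert, if_neg hc]

theorem exists_thr (L : List (Fin n)) (h : L.Pairwise (· < ·)) :
    ∀ L', L' <:+ L → ∃ c : ℕ, L'.toFinset = L.toFinset.filter (fun x : Fin n => c ≤ (x : ℕ)) := by
  induction L with
  | nil =>
    intro L' h
    rw [List.suffix_nil.mp h]
    exact ⟨0, by simp⟩
  | cons a L ih =>
    rw [List.pairwise_cons] at h
    intro L' hL'
    rcases List.suffix_cons_iff.mp hL' with rfl | hL'
    · refine ⟨0, by simp⟩
    · obtain ⟨c, hc⟩ := ih h.2 L' hL'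
      refine ⟨max c (a + 1), ?_⟩
      rw [hc]
      ext x
      simp only [Finset.mem_filter, List.mem_toFinset, List.mem_cons]
      constructor
      · rintro ⟨h1, h2⟩
        have := h.1 x h1
        exact ⟨Or.inr h1, by omega⟩
      · rintro ⟨rfl | h1, h2⟩
        · omega
        · exact ⟨h1, by omega⟩

/-- Increasing deletion through good sets. -/
def Inc (Good : Finset (Fin n) → Prop) (A A' : Finset (Fin n)) : Prop :=
  A' ⊆ A ∧ ∀ c, Good (thr A A' c)

theorem Inc.good {Good : Finset (Fin n) → Prop} {A A' : Finset (Fin n)} (h : Inc Good A A') :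
    Good A' := by
  have := h.2 n
  have e : thr A A' n = A' := by
    ext x; simp only [thr, Finset.mem_union, Finset.mem_filter]
    have := x.2
    constructor
    · rintro (h | ⟨_, h⟩)
      · exact h
      · omega
    · tauto
  rwa [e] at this

theorem thr_eq {A A' D : Finset (Fin n)} (h : A = D ∪ A') (c : ℕ) :
    thr A A' c = D.filter (fun x : Fin n => c ≤ (x : ℕ)) ∪ A' := by
  subst h
  ext x; simp only [thr, Finset.mem_union, Finset.mem_filter]; tauto

theorem inc_iff {Good : Finset (Fin n) → Prop} {L1 L2 : List (Fin n)} (h : L1.Pairwise (· < ·)) :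
    ((∀ L', L' <:+ L1 ++ L2 → Good L'.toFinset)) ↔
      Inc Good (L1 ++ L2).toFinset L2.toFinset ∧ (∀ L', L' <:+ L2 → Good L'.toFinset) := by
  constructor
  · intro hg
    refine ⟨⟨?_, ?_⟩, fun L' hL' => hg L' (hL'.trans (List.suffix_append _ _))⟩
    · rw [List.toFinset_append]; exact Finset.subset_union_right
    · intro c
      rw [thr_eq List.toFinset_append]
      obtain ⟨L', h1, h2⟩ := exists_suffix L1 h c
      rw [← h2, ← List.toFinset_append]
      apply hg
      obtain ⟨t, rfl⟩ := h1
      exact ⟨t, by simp⟩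
  · rintro ⟨⟨_, hi⟩, hg⟩ L' ⟨t, ht⟩
    rcases List.append_eq_append_iff.mp ht with ⟨a, h1, h2⟩ | ⟨a, h1, h2⟩
    · obtain ⟨c, hc⟩ := exists_thr L1 h a ⟨t, h1.symm⟩
      rw [h2, List.toFinset_append, hc, ← thr_eq List.toFinset_append]
      exact hi c
    · exact hg L' ⟨a, h2.symm⟩

/-- Good orderings of `A` with descents in `T`. -/
def ords (Good : Finset (Fin n) → Prop) (A : Finset (Fin n)) (T : Finset ℕ) : Set (List (Fin n)) :=
  {L | L.Nodup ∧ L.toFinset = A ∧ (∀ L', L' <:+ L → Good L'.toFinset) ∧ desc L ⊆ T}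

/-- Chains below `u` with rank set `T`. -/
def chains {α : Type*} (r : α → α → Prop) (rk : α → ℕ) (u : α) (T : Finset ℕ) : Set (Finset α) :=
  {C | (∀ a ∈ C, ∀ b ∈ C, r a b ∨ r b a) ∧ (∀ a ∈ C, r a u) ∧ C.image rk = T}

/-- A ranked relation parametrised by good subsets of `Fin n`. -/
structure Sys {α : Type*} (r : α → α → Prop) (rk : α → ℕ) (bot top : α)
    (Good : Finset (Fin n) → Prop) (p : Finset (Fin n) → α) : Prop where
  gu : Good Finset.univ
  ge : Good ∅
  pu : p Finset.univ = top
  pe : p ∅ = bot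
  rank : ∀ A, Good A → rk (p A) = A.card
  mono : ∀ A A', Good A → Good A' → A' ⊆ A → r (p A') (p A)
  rle : ∀ a b, r a b → rk a ≤ rk b
  req : ∀ a b, r a b → rk a = rk b → a = b
  ex : ∀ A u, Good A → r u (p A) → ∃ A', Inc Good A A' ∧ p A' = u
  uniq : ∀ A A' A'', Good A → Inc Good A A' → Inc Good A A'' → p A' = p A'' → A' = A''

theorem sort_lt (A : Finset (Fin n)) : (A.sort (· ≤ ·)).Pairwise (· < ·) :=
  (Finset.sortedLT_sort A).pairwise

theorem eq_sort {L : List (Fin n)} {A : Finset (Fin n)} (h : L.Pairwise (· < ·)) (hA : L.toFinset = A) :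
    L = A.sort (· ≤ ·) := by
  apply List.Perm.eq_of_pairwise' (r := (· < ·)) h (sort_lt A)
  rw [List.perm_ext_iff_of_nodup h.nodup (Finset.sort_nodup _ _)]
  intro a; simp [← hA]

variable {α : Type*} {r : α → α → Prop} {rk : α → ℕ} {bot top : α}
    {Good : Finset (Fin n) → Prop} {p : Finset (Fin n) → α}

theorem Sys.inc_empty (S : Sys r rk bot top Good p) {A : Finset (Fin n)} (hA : Good A) :
    Inc Good A ∅ := by
  obtain ⟨A', h1, h2⟩ := S.ex A bot hA (by
    rw [← S.pe]; exact S.mono _ _ hA S.ge (Finset.empty_subset _))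
  have h3 := S.rank A' h1.good
  have h4 := S.rank ∅ S.ge
  rw [h2, ← S.pe, h4, Finset.card_empty] at h3
  rwa [Finset.card_eq_zero.mp h3.symm] at h1

theorem Sys.ords_step (S : Sys r rk bot top Good p) (A : Finset (Fin n))
    (t : ℕ) (T : Finset ℕ) (hT : ∀ x ∈ T, x < t) (ht : t < A.card) :
    Nonempty ((Σ A' : {A' // Inc Good A A' ∧ A'.card = t}, ords Good A'.1 T) ≃
      ords Good A (insert t T)) := by
  have hcard : ∀ {L : List (Fin n)} {A'}, L.Nodup → L.toFinset = A' → L.length = A'.card := by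
    intro L A' h1 h2; rw [← h2, List.toFinset_card_of_nodup h1]
  let F : (Σ A' : {A' // Inc Good A A' ∧ A'.card = t}, ords Good A'.1 T) →
      ords Good A (insert t T) := fun x => ⟨(A \ x.1.1).sort (· ≤ ·) ++ x.2.1, by
    obtain ⟨⟨A', hA', hc⟩, ⟨L, h1, h2, h3, h4⟩⟩ := x
    change (A \ A').sort (· ≤ ·) ++ L ∈ ords Good A (insert t T)
    replace h2 : L.toFinset = A' := h2
    have htf : ((A \ A').sort (· ≤ ·) ++ L).toFinset = A := by
      rw [List.toFinset_append, h2, Finset.sort_toFinset, Finset.sdiff_union_of_subset hA'.1]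
    refine ⟨?_, htf, ?_, ?_⟩
    · rw [List.nodup_append]
      refine ⟨Finset.sort_nodup _ _, h1, ?_⟩
      rintro a ha b hb rfl
      rw [Finset.mem_sort, Finset.mem_sdiff, ← h2, List.mem_toFinset] at ha
      exact ha.2 hb
    · rw [inc_iff (sort_lt _), htf, h2]
      exact ⟨hA', h3⟩
    · refine (desc_append_sorted _ _ (sort_lt _)).trans ?_
      rw [hcard h1 h2, hc]
      exact Finset.insert_subset_insert _ h4⟩
  refine ⟨Equiv.ofBijective F ⟨?_, ?_⟩⟩
  · rintro ⟨⟨A', hA', hc⟩, ⟨L, h1, h2, h3, h4⟩⟩ ⟨⟨A'', hA'', hc'⟩, ⟨L', h1', h2', h3', h4'⟩⟩ he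
    have he' : (A \ A').sort (· ≤ ·) ++ L = (A \ A'').sort (· ≤ ·) ++ L' := congrArg Subtype.val he
    have : L = L' := (List.append_inj' he' (by rw [hcard h1 h2, hcard h1' h2', hc, hc'])).2
    subst this
    have : A' = A'' := h2.symm.trans h2'
    subst this
    rfl
  · rintro ⟨L, h1, h2, h3, h4⟩
    have hl := hcard h1 h2
    set L1 := L.take (L.length - t) with hL1
    set L2 := L.drop (L.length - t) with hL2
    have hL : L = L1 ++ L2 := (List.take_append_drop _ _).symm
    have hl2 : L2.length = t := by rw [hL2, List.length_drop]; omega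
    have hn := h1
    rw [hL, List.nodup_append] at hn
    have hs : L1.Pairwise (· < ·) := by
      apply sorted_of_desc L1 L2 hn.1
      rw [← hL]
      intro i hi
      have := h4 hi
      rw [Finset.mem_insert] at this
      rcases this with rfl | h
      · omega
      · have := hT i h; omega
    rw [hL, inc_iff hs, ← hL, h2] at h3
    have hc2 : L2.toFinset.card = t := by rw [List.toFinset_card_of_nodup hn.2.1, hl2]
    refine ⟨⟨⟨L2.toFinset, h3.1, hc2⟩, ⟨L2, hn.2.1, rfl, h3.2, ?_⟩⟩, ?_⟩
    · intro i hi
      have h5 := desc_lt L2 i hi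
      have h6 := h4 (hL ▸ desc_append_sub L1 L2 hi)
      rw [Finset.mem_insert] at h6
      rcases h6 with rfl | h6
      · omega
      · exact h6
    · apply Subtype.ext
      change (A \ L2.toFinset).sort (· ≤ ·) ++ L2 = L
      conv_rhs => rw [hL]
      congr 1
      symm
      apply eq_sort hs
      rw [← h2]
      conv_rhs => rw [hL]
      rw [List.toFinset_append, Finset.union_sdiff_right]
      symm
      apply Finset.sdiff_eq_self_of_disjoint
      rw [List.disjoint_toFinset_iff_disjoint]
      intro a ha hb
      exact hn.2.2 a ha a hb rfl

theorem Sys.chains_step (S : Sys r rk bot top Good p) (A : Finset (Fin n)) (hA : Good A)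
    (t : ℕ) (T : Finset ℕ) (hT : ∀ x ∈ T, x < t) :
    Nonempty ((Σ A' : {A' // Inc Good A A' ∧ A'.card = t}, chains r rk (p A'.1) T) ≃
      chains r rk (p A) (insert t T)) := by
  classical
  have hrk : ∀ {u : α} {C}, C ∈ chains r rk u T → ∀ a ∈ C, rk a < t := by
    intro u C hC a ha
    apply hT
    rw [← hC.2.2]
    exact Finset.mem_image_of_mem _ ha
  let F : (Σ A' : {A' // Inc Good A A' ∧ A'.card = t}, chains r rk (p A'.1) T) →
      chains r rk (p A) (insert t T) := fun x => ⟨insert (p x.1.1) x.2.1, by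
    obtain ⟨⟨A', hA', hc⟩, ⟨C, h1, h2, h3⟩⟩ := x
    change insert (p A') C ∈ chains r rk (p A) (insert t T)
    replace h2 : ∀ a ∈ C, r a (p A') := h2
    refine ⟨?_, ?_, ?_⟩
    · intro a ha b hb
      rw [Finset.mem_insert] at ha hb
      rcases ha with rfl | ha <;> rcases hb with rfl | hb
      · left; exact S.mono _ _ hA'.good hA'.good (Finset.Subset.refl _)
      · right; exact h2 _ hb
      · left; exact h2 _ ha
      · exact h1 a ha b hb
    · intro a ha
      rw [Finset.mem_insert] at ha
      rcases ha with rfl | ha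
      · exact S.mono _ _ hA hA'.good hA'.1
      · obtain ⟨A2, h4, rfl⟩ := S.ex A' a hA'.good (h2 a ha)
        exact S.mono _ _ hA h4.good (h4.1.trans hA'.1)
    · rw [Finset.image_insert, h3, S.rank _ hA'.good, hc]⟩
  refine ⟨Equiv.ofBijective F ⟨?_, ?_⟩⟩
  · rintro ⟨⟨A', hA', hc⟩, ⟨C, hC⟩⟩ ⟨⟨A'', hA'', hc'⟩, ⟨C', hC'⟩⟩ he
    have he' : insert (p A') C = insert (p A'') C' := congrArg Subtype.val he
    have r1 := S.rank _ hA'.good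
    have r2 := S.rank _ hA''.good
    have hp : p A' = p A'' := by
      have : p A' ∈ insert (p A'') C' := he' ▸ Finset.mem_insert_self _ _
      rw [Finset.mem_insert] at this
      rcases this with h | h
      · exact h
      · have := hrk hC' _ h; omega
    have := S.uniq A A' A'' hA hA' hA'' hp
    subst this
    have n1 : p A' ∉ C := fun h => by have := hrk hC _ h; omega
    have n2 : p A' ∉ C' := fun h => by have := hrk hC' _ h; omega
    have : C = C' := by
      rw [← Finset.erase_insert n1, he', Finset.erase_insert n2]
    subst this
    rfl
  · rintro ⟨C, h1, h2, h3⟩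
    have : t ∈ C.image rk := by rw [h3]; exact Finset.mem_insert_self _ _
    obtain ⟨u, hu, hut⟩ := Finset.mem_image.mp this
    obtain ⟨A', hA', hp⟩ := S.ex A u hA (h2 u hu)
    have hlt : ∀ a ∈ C.erase u, rk a < t := by
      intro a ha
      rw [Finset.mem_erase] at ha
      have h4 : rk a ∈ insert t T := h3 ▸ Finset.mem_image_of_mem _ ha.2
      rw [Finset.mem_insert] at h4
      rcases h4 with h4 | h4
      · exfalso
        apply ha.1
        rcases h1 a ha.2 u hu with h | h
        · exact S.req _ _ h (by rw [h4, hut])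
        · exact (S.req _ _ h (by rw [h4, hut])).symm
      · exact hT _ h4
    refine ⟨⟨⟨A', hA', by rw [← S.rank _ hA'.good, hp, hut]⟩, ⟨C.erase u, ?_, ?_, ?_⟩⟩, ?_⟩
    · intro a ha b hb
      exact h1 a (Finset.mem_of_mem_erase ha) b (Finset.mem_of_mem_erase hb)
    · intro a ha
      rw [hp]
      rcases h1 a (Finset.mem_of_mem_erase ha) u hu with h | h
      · exact h
      · have := S.rle _ _ h
        have := hlt a ha
        omega
    · have htT : t ∉ T := fun h => lt_irrefl _ (hT t h)
      have htC : t ∉ (C.erase u).image rk := by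
        intro h
        obtain ⟨a, ha, hat⟩ := Finset.mem_image.mp h
        have := hlt a ha; omega
      have : insert t ((C.erase u).image rk) = insert t T := by
        rw [← h3, ← hut, ← Finset.image_insert, Finset.insert_erase hu]
      rw [← Finset.erase_insert htC, this, Finset.erase_insert htT]
    · apply Subtype.ext
      change insert (p A') (C.erase u) = C
      rw [hp, Finset.insert_erase hu]

theorem Sys.count (S : Sys r rk bot top Good p) (T : Finset ℕ) : ∀ A, Good A →
    (∀ t ∈ T, t < A.card) → Nonempty (chains r rk (p A) T ≃ ords Good A T) := by
  induction T using Finset.induction_on_max with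
  | empty =>
    intro A hA _
    have h1 : chains r rk (p A) ∅ = {∅} := by
      ext C
      constructor
      · rintro ⟨_, _, h⟩
        exact Finset.image_eq_empty.mp h
      · rintro rfl
        exact ⟨by simp, by simp, by simp⟩
    have h2 : ords Good A ∅ = {A.sort (· ≤ ·)} := by
      ext L
      constructor
      · rintro ⟨h1, h2, h3, h4⟩
        apply eq_sort _ h2
        apply sorted_of_desc L [] h1
        intro i hi
        rw [List.append_nil] at hi
        simpa using h4 hi
      · rintro rfl
        refine ⟨Finset.sort_nodup _ _, Finset.sort_toFinset _ _, ?_, ?_⟩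
        · have := (inc_iff (Good := Good) (L2 := []) (sort_lt A)).mpr
          simp only [List.append_nil, Finset.sort_toFinset] at this
          apply this
          refine ⟨S.inc_empty hA, ?_⟩
          intro L' h
          rw [List.suffix_nil.mp h]
          exact S.ge
        · intro i hi
          have h5 := desc_append_sorted _ [] (sort_lt A)
          rw [List.append_nil] at h5
          have h6 := h5 hi
          simp [desc] at h6
          exact absurd hi (by
            subst h6
            generalize A.sort (· ≤ ·) = L
            induction L with
            | nil => simp [desc]
            | cons a L ih =>
              cases L with
              | nil => simp [desc]
              | cons b L =>
                simp only [desc]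
                split_ifs
                · simp [ih]
                · exact ih)
    rw [h1, h2]
    exact ⟨Equiv.ofUnique _ _⟩
  | insert t T hT ih =>
    intro A hA hlt
    obtain ⟨e1⟩ := S.chains_step A hA t T hT
    obtain ⟨e2⟩ := S.ords_step A t T hT (hlt t (Finset.mem_insert_self _ _))
    have : ∀ A' : {A' // Inc Good A A' ∧ A'.card = t},
        Nonempty (chains r rk (p A'.1) T ≃ ords Good A'.1 T) := fun A' =>
      ih A'.1 A'.2.1.good (by rw [A'.2.2]; exact hT)
    exact ⟨e1.symm.trans ((Equiv.sigmaCongrRight fun A' => (this A').some).trans e2)⟩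

theorem Sys.flagAlpha_eq (S : Sys r rk bot top Good p) (T : Finset ℕ)
    (hT : T ⊆ Finset.Icc 1 (n - 1)) :
    flagAlpha r rk bot top T = (ords Good Finset.univ T).ncard := by
  have hT' : ∀ t ∈ T, 0 < t ∧ t < n := by
    intro t ht
    have := hT ht
    rw [Finset.mem_Icc] at this
    omega
  obtain ⟨e⟩ := S.count T Finset.univ S.gu (by simpa using fun t ht => (hT' t ht).2)
  rw [S.pu] at e
  have : {C : Finset α | (∀ a ∈ C, ∀ b ∈ C, r a b ∨ r b a) ∧
      (∀ a ∈ C, r bot a ∧ r a top ∧ a ≠ bot ∧ a ≠ top) ∧ C.image rk = T} = chains r rk top T := by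
    ext C
    constructor
    · rintro ⟨h1, h2, h3⟩
      exact ⟨h1, fun a ha => (h2 a ha).2.1, h3⟩
    · rintro ⟨h1, h2, h3⟩
      refine ⟨h1, fun a ha => ?_, h3⟩
      have hr := hT' (rk a) (h3 ▸ Finset.mem_image_of_mem _ ha)
      have hrb := S.rank ∅ S.ge
      have hrt := S.rank Finset.univ S.gu
      rw [S.pe] at hrb
      rw [S.pu] at hrt
      simp at hrb hrt
      refine ⟨?_, h2 a ha, ?_, ?_⟩
      · obtain ⟨A, hA, rfl⟩ := S.ex Finset.univ a S.gu (S.pu ▸ h2 a ha)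
        rw [← S.pe]
        exact S.mono _ _ hA.good S.ge (Finset.empty_subset _)
      · rintro rfl; omega
      · rintro rfl; omega
  rw [flagAlpha, this]
  exact Nat.card_congr e

theorem ords_finite (A : Finset (Fin n)) (T : Finset ℕ) : (ords Good A T).Finite := by
  apply (List.finite_length_le (Fin n) n).subset
  rintro L ⟨h1, -⟩
  simpa using h1.length_le_card

theorem alt_sum (D S : Finset ℕ) :
    ∑ T ∈ S.powerset, (-1 : ℤ) ^ ((S \ T).card) * (if D ⊆ T then 1 else 0) =
      if D = S then 1 else 0 := by
  have h1 : ∑ T ∈ S.powerset, (-1 : ℤ) ^ ((S \ T).card) * (if D ⊆ T then 1 else 0) =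
      ∑ U ∈ S.powerset, (-1 : ℤ) ^ U.card * (if D ⊆ S \ U then 1 else 0) := by
    apply Finset.sum_nbij' (fun T => S \ T) (fun T => S \ T)
    · intro T _; simp
    · intro T _; simp
    · intro T hT; rw [Finset.mem_powerset] at hT; simp [hT]
    · intro T hT; rw [Finset.mem_powerset] at hT; simp [hT]
    · intro T hT; rw [Finset.mem_powerset] at hT; simp [hT]
  rw [h1]
  by_cases hD : D ⊆ S
  · have h2 : ∑ U ∈ S.powerset, (-1 : ℤ) ^ U.card * (if D ⊆ S \ U then 1 else 0) =
        ∑ U ∈ (S \ D).powerset, (-1 : ℤ) ^ U.card := by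
      simp only [mul_ite, mul_one, mul_zero]
      rw [← Finset.sum_filter]
      apply Finset.sum_congr _ fun _ _ => rfl
      ext U
      simp only [Finset.mem_filter, Finset.mem_powerset, Finset.subset_sdiff]
      constructor
      · rintro ⟨h, _, h'⟩; exact ⟨h, h'.symm⟩
      · rintro ⟨h, h'⟩; exact ⟨h, hD, h'.symm⟩
    rw [h2, Finset.sum_powerset_neg_one_pow_card]
    have h3 : (S \ D = ∅) ↔ D = S := by
      rw [Finset.sdiff_eq_empty_iff_subset]
      exact ⟨fun h => Finset.Subset.antisymm hD h, fun h => h ▸ Finset.Subset.refl _⟩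
    simp only [h3]
  · rw [if_neg (show ¬ D = S from fun h => hD (h ▸ Finset.Subset.refl _))]
    apply Finset.sum_eq_zero
    intro U _
    rw [if_neg (fun h => hD (h.trans Finset.sdiff_subset)), mul_zero]

theorem Sys.flagBeta_eq (S : Sys r rk bot top Good p) (T : Finset ℕ)
    (hT : T ⊆ Finset.Icc 1 (n - 1)) :
    flagBeta r rk bot top T = ({L ∈ ords Good Finset.univ T | desc L = T}.ncard : ℤ) := by
  classical
  set G := (ords_finite (Good := Good) Finset.univ T).toFinset with hG
  have h1 : ∀ T' ∈ T.powerset, (flagAlpha r rk bot top T' : ℤ) =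
      ∑ L ∈ G, if desc L ⊆ T' then 1 else 0 := by
    intro T' hT'
    rw [Finset.mem_powerset] at hT'
    rw [S.flagAlpha_eq T' (hT'.trans hT), ← Finset.sum_filter, Finset.sum_const, nsmul_eq_mul, mul_one,
      ← Set.ncard_coe_finset]
    congr 2
    ext L
    simp only [hG, Finset.coe_filter, Set.Finite.mem_toFinset, Set.mem_ofPred_eq, ords]
    constructor
    · rintro ⟨a, b, c, d⟩; exact ⟨⟨a, b, c, d.trans hT'⟩, d⟩
    · rintro ⟨⟨a, b, c, _⟩, d⟩; exact ⟨a, b, c, d⟩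
  rw [flagBeta, Finset.sum_congr rfl fun T' hT' => by rw [h1 T' hT', Finset.mul_sum],
    Finset.sum_comm, Finset.sum_congr rfl fun L _ => alt_sum (desc L) T, ← Finset.sum_filter,
    Finset.sum_const, nsmul_eq_mul, mul_one, ← Set.ncard_coe_finset]
  congr 2
  ext L
  simp [hG]

end Count

theorem boolSys (n : ℕ) : Sys (n := n) (α := Finset (Fin n)) (· ⊆ ·) Finset.card ⊥ ⊤
    (fun _ => True) id where
  gu := trivial
  ge := trivial
  pu := rfl
  pe := rfl
  rank := fun _ _ => rfl
  mono := fun _ _ _ _ h => h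
  rle := fun _ _ h => Finset.card_le_card h
  req := fun _ _ h he => Finset.eq_of_subset_of_card_le h he.ge
  ex := fun A u _ h => ⟨u, ⟨h, fun _ => trivial⟩, rfl⟩
  uniq := fun _ _ _ _ _ _ h => h

theorem bruhatSys {B W : Type*} [Group W] {M : CoxeterMatrix B} (cs : CoxeterSystem M W)
    {n : ℕ} (f : Fin n → B) (hf : Gd cs f Finset.univ) :
    Sys (bruhatLE cs) cs.length 1 (P cs f Finset.univ) (Gd cs f) (P cs f) where
  gu := hf
  ge := by rw [Gd, P_empty]; simp
  pu := rfl
  pe := P_empty cs f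
  rank := fun _ h => h
  mono := fun _ _ h h' hs => bruhatLE_of_subset cs f h h' hs
  rle := fun _ _ h => (bruhatLE_length cs h).1
  req := fun _ _ h => (bruhatLE_length cs h).2
  ex := fun A u hA h => by
    obtain ⟨A', h1, h2, h3, _⟩ := exists_inc cs f A hA u (ble_of_bruhatLE cs h)
    exact ⟨A', ⟨h1, h3⟩, h2⟩
  uniq := fun A A' A'' _ h1 h2 h => unique_inc cs f A A' A'' h1.1 h2.1 h1.2 h2.2 h

theorem exists_rep {B W : Type*} [Group W] {M : CoxeterMatrix B} (cs : CoxeterSystem M W) (w : W) :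
    ∃ f : Fin (cs.length w) → B, P cs f Finset.univ = w := by
  obtain ⟨l, hl, rfl⟩ := cs.exists_isReduced w
  rw [hl.eq]
  refine ⟨l.get, ?_⟩
  rw [P, subw]
  have : (Finset.univ : Finset (Fin l.length)).sort (· ≤ ·) = List.finRange l.length := by
    symm
    apply eq_sort (List.pairwise_lt_finRange _)
    ext; simp
  rw [this]
  congr 1
  simp

end BFH

/-- the flag h-vector of a lower Bruhat interval `[1,w]` is
coefficientwise bounded above by the flag h-vector of the Boolean algebra
`B_{l(w)}` (encoded as `Finset (Fin (l(w)))` ordered by inclusion, graded by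
cardinality): `β_{[1,w]}(S) ≤ β_{B_{l(w)}}(S)` for every `S ⊆ [l(w) − 1]`. -/
theorem bruhat_flag_h_le_boolean {B W : Type*} [Group W] {M : CoxeterMatrix B}
    (cs : CoxeterSystem M W) (w : W) :
    ∀ S ∈ (Finset.Icc 1 (cs.length w - 1)).powerset,
      flagBeta (bruhatLE cs) cs.length 1 w S ≤
      flagBeta (α := Finset (Fin (cs.length w))) (· ⊆ ·) Finset.card
        (⊥ : Finset (Fin (cs.length w))) (⊤ : Finset (Fin (cs.length w))) S := by
  intro S hS
  rw [Finset.mem_powerset] at hS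
  obtain ⟨f, hf⟩ := BFH.exists_rep cs w
  have hg : BFH.Gd cs f Finset.univ := by rw [BFH.Gd, hf]; simp
  have h1 := BFH.bruhatSys cs f hg
  rw [hf] at h1
  rw [h1.flagBeta_eq S hS, (BFH.boolSys (cs.length w)).flagBeta_eq S hS]
  norm_cast
  apply Set.ncard_le_ncard
  · rintro L ⟨⟨a, b, _, d⟩, e⟩
    exact ⟨⟨a, b, fun _ _ => trivial, d⟩, e⟩
  · exact (BFH.ords_finite _ _).subset fun L h => h.1
end

section
/- Let (W,S) be a Coxeter system, s ∈ S, u ≤ w with u < us, w < ws, and us ∈ [u,w]. Order the elements {v ∈ (u,w) : vs < v} as v₁,…,v_k so that ranks weakly increase, set P₀ = [u,w] × [1,s], and for i ≥ 1 let P_i be obtained from P_{i−1} by zipping ((v_i,1),(v_is,s),(v_i,s)). Then for each 1 ≤ i ≤ k, the interval [(u,1),(v_i,1)] in P_{i−1} is isomorphic to the interval [(u,1),(v_i,1)] in P₀ (equivalently to the Bruhat interval [u,v_i]), and the interval [(v_i,s),(w,s)] in P_{i−1} is isomorphic to the interval [(v_i,s),(w,s)] in P₀ (equivalently to [v_i,w]).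 -/
/-- The componentwise order on `[u,w] × [1,s]`, with the two-element chain `[1,s]`
encoded as `Bool` (`false = 1 < s = true`), the first component ordered by Bruhat
order. -/
def prodRel {B W : Type*} [Group W] {M : CoxeterMatrix B}
    (cs : CoxeterSystem M W) : W × Bool → W × Bool → Prop :=
  fun a b => bruhatLE cs a.1 b.1 ∧ a.2 ≤ b.2

/-- The effect of zipping the zipper `(x, y, z)` on the order relation: `z` is
deleted and `y` is identified with `x` (so `x` represents the new element `xy`):
`a ⪯ b` iff `a ≤ b`, or `a = x` (i.e. `a` is the class `xy`) and `y ≤ b`. -/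
def zipRelOn {γ : Type*} (r : γ → γ → Prop) (x y : γ) : γ → γ → Prop :=
  fun a b => r a b ∨ (a = x ∧ r y b)

/-- The sequence of order relations `P₀, P₁, P₂, …`: `P₀ = [u,w] × [1,s]` and
`P_i` is obtained from `P_{i−1}` by zipping `((v_i,1), (v_i s, s), (v_i, s))`. -/
def relSeq {B W : Type*} [Group W] {M : CoxeterMatrix B}
    (cs : CoxeterSystem M W) (s : B) (v : ℕ → W) : ℕ → (W × Bool → W × Bool → Prop)
  | 0 => prodRel cs
  | i + 1 => zipRelOn (relSeq cs s v i) (v i, false) (v i * cs.simple s, true)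

/-- The carrier of `P_i`: the zipping at step `j` deletes `(v_j, s)` and merges
`(v_j s, s)` into `(v_j, 1)`. -/
def carrierSeq {B W : Type*} [Group W] {M : CoxeterMatrix B}
    (cs : CoxeterSystem M W) (s : B) (v : ℕ → W) (i : ℕ) : Set (W × Bool) :=
  {p | ∀ j < i, p ≠ (v j, true) ∧ p ≠ (v j * cs.simple s, true)}

theorem bruhatLE_length {B W : Type*} [Group W] {M : CoxeterMatrix B}
    (cs : CoxeterSystem M W) {x y : W} (h : bruhatLE cs x y) :
    cs.length x ≤ cs.length y ∧ (cs.length y ≤ cs.length x → x = y) := by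
  obtain ⟨lv, lu, h1, rfl, h2, rfl, hs⟩ := h
  rw [h1.eq, h2.eq]
  exact ⟨hs.length_le, fun h => by rw [hs.eq_of_length_le h]⟩

theorem relSeq_true {B W : Type*} [Group W] {M : CoxeterMatrix B}
    (cs : CoxeterSystem M W) (s : B) (v : ℕ → W) (i : ℕ) (x : W) (b : W × Bool) :
    relSeq cs s v i (x, true) b ↔ prodRel cs (x, true) b := by
  induction i with
  | zero => rfl
  | succ n ih => simp [relSeq, zipRelOn, ih]

theorem relSeq_iff {B W : Type*} [Group W] {M : CoxeterMatrix B}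
    (cs : CoxeterSystem M W) (s : B) (v : ℕ → W) (i : ℕ) (a b : W × Bool) :
    relSeq cs s v i a b ↔ prodRel cs a b ∨
      ∃ j < i, a = (v j, false) ∧ prodRel cs (v j * cs.simple s, true) b := by
  induction i with
  | zero => simp [relSeq]
  | succ n ih =>
    simp only [relSeq, zipRelOn, ih, relSeq_true]
    constructor
    · rintro ((h | ⟨j, hj, h⟩) | h)
      · exact Or.inl h
      · exact Or.inr ⟨j, by omega, h⟩
      · exact Or.inr ⟨n, by omega, h⟩
    · rintro (h | ⟨j, hj, h⟩)
      · exact Or.inl (Or.inl h)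
      · rcases Nat.lt_succ_iff_lt_or_eq.mp hj with hj | rfl
        · exact Or.inl (Or.inr ⟨j, hj, h⟩)
        · exact Or.inr h

theorem relSeq_to_false {B W : Type*} [Group W] {M : CoxeterMatrix B}
    (cs : CoxeterSystem M W) (s : B) (v : ℕ → W) (i : ℕ) (a : W × Bool) (y : W) :
    relSeq cs s v i a (y, false) ↔ prodRel cs a (y, false) := by
  rw [relSeq_iff]
  constructor
  · rintro (h | ⟨j, hj, -, -, h⟩)
    · exact h
    · exact absurd h (by simp)
  · exact Or.inl

/-- with `v₁, …, v_k` an enumeration of `{v ∈ (u,w) : vs < v}` with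
weakly increasing ranks, and `P_i` the sequence of zipped posets starting from
`P₀ = [u,w] × [1,s]`: for each `i`, the interval `[(u,1),(v_i,1)]` of `P_{i−1}`
coincides (as a set, with the same order) with the interval `[(u,1),(v_i,1)]` of
`P₀`, and likewise the interval `[(v_i,s),(w,s)]` of `P_{i−1}` coincides with
that of `P₀`.  (Indices are 0-based: `P_{i-1}` is `relSeq cs s v i.pred`, with
zipper index `v i.pred`; here `i.pred = i − 1` ranges over `0, …, k−1`.) -/
theorem zipping_sequence_intervals {B W : Type*} [Group W] {M : CoxeterMatrix B}
    (cs : CoxeterSystem M W) (u w : W) (s : B)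
    (huw : bruhatLE cs u w)
    (hu : bruhatLT cs u (u * cs.simple s))
    (hw : bruhatLT cs w (w * cs.simple s))
    (hus : bruhatLE cs (u * cs.simple s) w)
    (k : ℕ) (v : ℕ → W)
    (henum : ∀ x : W,
      (bruhatLT cs u x ∧ bruhatLT cs x w ∧ bruhatLT cs (x * cs.simple s) x) ↔
      ∃ j < k, v j = x)
    (hinj : ∀ j₁ < k, ∀ j₂ < k, v j₁ = v j₂ → j₁ = j₂)
    (hmono : ∀ j₁ j₂, j₁ ≤ j₂ → j₂ < k → cs.length (v j₁) ≤ cs.length (v j₂)) :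
    ∀ i < k,
      -- the lower interval [(u,1),(v_{i+1},1)] in P_i equals that in P₀ ...
      ({p | p ∈ carrierSeq cs s v i ∧
          relSeq cs s v i (u, false) p ∧ relSeq cs s v i p (v i, false)} =
        {p | prodRel cs (u, false) p ∧ prodRel cs p (v i, false)}) ∧
      -- ... with the same order relation
      (∀ a b : W × Bool,
        (prodRel cs (u, false) a ∧ prodRel cs a (v i, false)) →
        (prodRel cs (u, false) b ∧ prodRel cs b (v i, false)) →
        (relSeq cs s v i a b ↔ prodRel cs a b)) ∧
      -- the upper interval [(v_{i+1},s),(w,s)] in P_i equals that in P₀ ...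
      ({p | p ∈ carrierSeq cs s v i ∧
          relSeq cs s v i (v i, true) p ∧ relSeq cs s v i p (w, true)} =
        {p | prodRel cs (v i, true) p ∧ prodRel cs p (w, true)}) ∧
      -- ... with the same order relation
      (∀ a b : W × Bool,
        (prodRel cs (v i, true) a ∧ prodRel cs a (w, true)) →
        (prodRel cs (v i, true) b ∧ prodRel cs b (w, true)) →
        (relSeq cs s v i a b ↔ prodRel cs a b)) := by
  intro i hi
  have hlow : ∀ y : W × Bool, prodRel cs y (v i, false) → y.2 = false := by
    rintro ⟨y, b⟩ ⟨-, h⟩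
    revert h; cases b <;> simp
  have hup : ∀ y : W × Bool, prodRel cs (v i, true) y → y.2 = true := by
    rintro ⟨y, b⟩ ⟨-, h⟩
    revert h; cases b <;> simp
  refine ⟨?_, ?_, ?_, ?_⟩
  · ext p
    simp only [Set.mem_setOf_eq, relSeq_to_false]
    constructor
    · rintro ⟨-, h1, h2⟩
      refine ⟨?_, h2⟩
      obtain ⟨p, b⟩ := p
      obtain rfl : b = false := hlow _ h2
      exact (relSeq_to_false ..).1 h1
    · rintro ⟨h1, h2⟩
      refine ⟨?_, (relSeq_iff ..).2 (Or.inl h1), h2⟩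
      have := hlow _ h2
      intro j _
      constructor <;> rintro rfl <;> simp at this
  · rintro a ⟨b, c⟩ - ⟨-, hb⟩
    obtain rfl : c = false := hlow _ hb
    exact relSeq_to_false ..
  · ext p
    simp only [Set.mem_setOf_eq, relSeq_true]
    constructor
    · rintro ⟨-, h1, h2⟩
      refine ⟨h1, ?_⟩
      obtain ⟨p, b⟩ := p
      obtain rfl : b = true := hup _ h1
      exact (relSeq_true ..).1 h2
    · rintro ⟨h1, h2⟩
      refine ⟨?_, h1, (relSeq_iff ..).2 (Or.inl h2)⟩
      intro j hj
      have hm := hmono j i hj.le hi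
      constructor
      · rintro rfl
        have h := (bruhatLE_length cs h1.1).2 hm
        have := hinj i hi j (hj.trans hi) h
        omega
      · rintro rfl
        have h := (bruhatLE_length cs h1.1).1
        obtain ⟨-, -, h3, h4⟩ := (henum (v j)).2 ⟨j, hj.trans hi, rfl⟩
        exact h4 ((bruhatLE_length cs h3).2 (hm.trans h))
  · rintro ⟨a, c⟩ b ⟨ha, -⟩ -
    obtain rfl : c = true := hup _ ha
    exact relSeq_true ..
end
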